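/- arXiv:1212.6466 — 2 statements merged into one kernel-verified Lean document; each statement's English description precedes it below -/
import Mathlib

section
/- Let G be a 2-connected o-heavy graph on n vertices. If for every induced copy H of Z_2 in G and every pair of vertices u, v at distance 2 within H, max{deg_G(u), deg_G(v)} ≥ n/2, then G is Hamiltonian. -/
open SimpleGraph

/-- `G` is 2-connected: at least 3 vertices and deleting any single vertex leaves
a connected graph. -/
def TwoConnected {V : Type*} [Fintype V] (G : SimpleGraph V) : Prop :=
  3 ≤ Fintype.card V ∧ ∀ v : V, (G.induce {w | w ≠ v}).Connected

/-- `c, a, b, d` form an induced claw (`K_{1,3}`) in `G` with center `c` and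
end-vertices `a`, `b`, `d`. -/
def IsInducedClaw {V : Type*} (G : SimpleGraph V) (c a b d : V) : Prop :=
  a ≠ b ∧ a ≠ d ∧ b ≠ d ∧
  G.Adj c a ∧ G.Adj c b ∧ G.Adj c d ∧
  ¬G.Adj a b ∧ ¬G.Adj a d ∧ ¬G.Adj b d

/-- `a₁, a₂, a₃, b₁` form an induced copy of `Z₁` in `G`: triangle `a₁a₂a₃` with
pendant edge `a₁b₁`. -/
def IsInducedZ1 {V : Type*} (G : SimpleGraph V) (a1 a2 a3 b1 : V) : Prop :=
  G.Adj a1 a2 ∧ G.Adj a1 a3 ∧ G.Adj a2 a3 ∧ G.Adj a1 b1 ∧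
  b1 ≠ a2 ∧ b1 ≠ a3 ∧ ¬G.Adj b1 a2 ∧ ¬G.Adj b1 a3

/-- `a₁, a₂, a₃, b₁, c₁` form an induced copy of `Z₂` in `G`: triangle `a₁a₂a₃`
with path `a₁b₁c₁` attached at `a₁`. -/
def IsInducedZ2 {V : Type*} (G : SimpleGraph V) (a1 a2 a3 b1 c1 : V) : Prop :=
  G.Adj a1 a2 ∧ G.Adj a1 a3 ∧ G.Adj a2 a3 ∧ G.Adj a1 b1 ∧ G.Adj b1 c1 ∧
  b1 ≠ a2 ∧ b1 ≠ a3 ∧ c1 ≠ a1 ∧ c1 ≠ a2 ∧ c1 ≠ a3 ∧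
  ¬G.Adj b1 a2 ∧ ¬G.Adj b1 a3 ∧ ¬G.Adj c1 a1 ∧ ¬G.Adj c1 a2 ∧ ¬G.Adj c1 a3
/-- A vertex is heavy if its degree is at least `n/2`. -/
def Heavy {V : Type*} [Fintype V] (G : SimpleGraph V) [DecidableRel G.Adj] (v : V) : Prop :=
  Fintype.card V ≤ 2 * G.degree v

/-- `G` is 1-heavy: every induced claw has at least one heavy end-vertex. -/
def OneHeavy {V : Type*} [Fintype V] (G : SimpleGraph V) [DecidableRel G.Adj] : Prop :=
  ∀ c a b d : V, IsInducedClaw G c a b d → Heavy G a ∨ Heavy G b ∨ Heavy G d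

/-- `G` is 2-heavy: every induced claw has at least two heavy end-vertices. -/
def TwoHeavy {V : Type*} [Fintype V] (G : SimpleGraph V) [DecidableRel G.Adj] : Prop :=
  ∀ c a b d : V, IsInducedClaw G c a b d →
    (Heavy G a ∧ Heavy G b) ∨ (Heavy G a ∧ Heavy G d) ∨ (Heavy G b ∧ Heavy G d)

/-- `G` is o-heavy: every induced claw has two end-vertices with degree sum
at least `n`. -/
def OHeavy {V : Type*} [Fintype V] (G : SimpleGraph V) [DecidableRel G.Adj] : Prop :=
  ∀ c a b d : V, IsInducedClaw G c a b d →
    Fintype.card V ≤ G.degree a + G.degree b ∨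
    Fintype.card V ≤ G.degree a + G.degree d ∨
    Fintype.card V ≤ G.degree b + G.degree d

/-- The pair `u, v` satisfies Fan's condition (`max{d(u),d(v)} ≥ n/2`) or Shi's
condition (`|N(u) ∩ N(v)| ≥ 2`). -/
def FanOrShi {V : Type*} [Fintype V] [DecidableEq V]
    (G : SimpleGraph V) [DecidableRel G.Adj] (u v : V) : Prop :=
  Fintype.card V ≤ 2 * G.degree u ∨ Fintype.card V ≤ 2 * G.degree v ∨
  2 ≤ (G.neighborFinset u ∩ G.neighborFinset v).card

section

variable {V : Type*} [DecidableEq V]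

/-- `G` has a path from `a` to `b` whose vertex set is `s`. -/
inductive IsPathOn (G : SimpleGraph V) : V → V → Finset V → Prop
  | single (a : V) : IsPathOn G a a {a}
  | cons {a b c : V} {s : Finset V} (hab : G.Adj a b) (ha : a ∉ s) (h : IsPathOn G b c s) :
      IsPathOn G a c (insert a s)

/-- `G` has a cycle whose vertex set is `s`. -/
def IsCycleOn (G : SimpleGraph V) (s : Finset V) : Prop :=
  3 ≤ s.card ∧ ∃ a b, IsPathOn G a b s ∧ G.Adj b a

namespace IsPathOn

variable {G H : SimpleGraph V} {a b c d : V} {s t : Finset V}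

theorem left_mem (h : IsPathOn G a b s) : a ∈ s := by
  cases h <;> simp

theorem right_mem (h : IsPathOn G a b s) : b ∈ s := by
  induction h <;> simp_all

theorem mono (hGH : G ≤ H) (h : IsPathOn G a b s) : IsPathOn H a b s := by
  induction h with
  | single a => exact .single a
  | cons hab ha _ ih => exact .cons (hGH hab) ha ih

theorem append (h : IsPathOn G a b s) (hbc : G.Adj b c) (h' : IsPathOn G c d t)
    (hst : Disjoint s t) : IsPathOn G a d (s ∪ t) := by
  induction h with
  | single a =>
    rw [← Finset.insert_eq]
    exact .cons hbc (by simpa using hst) h'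
  | cons hab ha _ ih =>
    rw [Finset.insert_union]
    rw [Finset.disjoint_insert_left] at hst
    exact .cons hab (by simp [ha, hst.1]) (ih hbc hst.2)

theorem reverse (h : IsPathOn G a b s) : IsPathOn G b a s := by
  induction h with
  | single a => exact .single a
  | @cons a b c s hab ha _ ih =>
    rw [Finset.insert_eq, Finset.union_comm]
    exact ih.append hab.symm (.single a) (by simpa using ha)

theorem eq_singleton (h : IsPathOn G a a s) : s = {a} := by
  cases h with
  | single => rfl
  | cons hab ha h => exact absurd h.right_mem ha

theorem one_lt_card (h : IsPathOn G a b s) (hab : a ≠ b) : 1 < s.card :=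
  Finset.one_lt_card.2 ⟨a, h.left_mem, b, h.right_mem, hab⟩

theorem uncons (h : IsPathOn G a b s) :
    (a = b ∧ s = {a}) ∨
      ∃ a' s', G.Adj a a' ∧ IsPathOn G a' b s' ∧ a ∉ s' ∧ s = insert a s' := by
  cases h with
  | single => exact .inl ⟨rfl, rfl⟩
  | cons hab ha h => exact .inr ⟨_, _, hab, h, ha, rfl⟩

theorem split_at (h : IsPathOn G a b s) (hc : c ∈ s) (hca : c ≠ a) :
    ∃ c' s₁ s₂, IsPathOn G a c' s₁ ∧ G.Adj c' c ∧ IsPathOn G c b s₂ ∧ Disjoint s₁ s₂ ∧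
      s₁ ∪ s₂ = s := by
  induction h with
  | single a => simp_all
  | @cons a b d s hab ha h ih =>
    have hcs : c ∈ s := by simpa [hca] using hc
    by_cases hcb : c = b
    · subst hcb
      exact ⟨a, {a}, s, .single a, hab, h, by simpa using ha, rfl⟩
    · obtain ⟨c', s₁, s₂, h₁, hcc, h₂, hd, rfl⟩ := ih hcs hcb
      refine ⟨c', insert a s₁, s₂, .cons hab (by grind) h₁, hcc, h₂, ?_, Finset.insert_union ..⟩
      rw [Finset.disjoint_insert_left]
      exact ⟨by grind, hd⟩

theorem exists_subset_of_reflTransGen {S : Finset V} (ha : a ∉ S)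
    (h : Relation.ReflTransGen (fun x y => G.Adj x y ∧ x ∉ S ∧ y ∉ S) a b) :
    ∃ s, IsPathOn G a b s ∧ Disjoint s S := by
  induction h with
  | refl => exact ⟨{a}, .single a, by simpa using ha⟩
  | @tail b c _ hbc ih =>
    obtain ⟨s, hs, hd⟩ := ih
    by_cases hc : c ∈ s
    · by_cases hca : c = a
      · exact ⟨{a}, hca.symm ▸ .single a, by simpa using ha⟩
      · obtain ⟨c', s₁, s₂, h₁, hcc, h₂, hd', rfl⟩ := hs.split_at hc hca
        refine ⟨s₁ ∪ {c}, h₁.append hcc (.single c) ?_, ?_⟩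
        · rw [Finset.disjoint_singleton_right]
          exact fun h => Finset.disjoint_left.1 hd' h h₂.left_mem
        · rw [Finset.disjoint_union_left, Finset.disjoint_singleton_left]
          exact ⟨(Finset.disjoint_union_left.1 hd).1, hbc.2.2⟩
    · exact ⟨s ∪ {c}, hs.append hbc.1 (.single c) (by simpa using hc), by grind⟩

theorem exists_of_isClique (hs : s.Nonempty) (h : G.IsClique (s : Set V)) :
    ∃ a b, IsPathOn G a b s := by
  induction hs using Finset.Nonempty.cons_induction with
  | singleton a => exact ⟨a, a, .single a⟩
  | cons a s ha hs ih =>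
    obtain ⟨b, c, hbc⟩ := ih (h.subset (by simp))
    rw [Finset.cons_eq_insert] at h ⊢
    refine ⟨a, c, .cons (h (by simp) (by simp [hbc.left_mem]) ?_) ha hbc⟩
    rintro rfl
    exact ha hbc.left_mem

theorem exists_walk (h : IsPathOn G a b s) :
    ∃ p : G.Walk a b, p.IsPath ∧ ∀ x, x ∈ p.support ↔ x ∈ s := by
  induction h with
  | single a => exact ⟨.nil, by simp⟩
  | cons hab ha _ ih =>
    obtain ⟨p, hp, hs⟩ := ih
    exact ⟨.cons hab p, by simp [hp, hs, ha]⟩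

/-- Either some edge of the path leads from a vertex satisfying `Q` to one satisfying `P`, or
`P` and `Q` hold few times on the path. -/
theorem exists_split_or_card_lt (P Q : V → Prop) [DecidablePred P] [DecidablePred Q]
    (h : IsPathOn G a b s) :
    (∃ c c' s₁ s₂, IsPathOn G a c s₁ ∧ IsPathOn G c' b s₂ ∧ Disjoint s₁ s₂ ∧ s₁ ∪ s₂ = s ∧
      Q c ∧ P c') ∨ ((s.erase a).filter P).card + ((s.erase b).filter Q).card < s.card := by
  induction h with
  | single a => right; simp
  | @cons a b c s hab ha h ih =>
    rcases ih with ⟨e, e', s₁, s₂, h₁, h₂, hd, rfl, hQ, hP⟩ | ih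
    · left
      refine ⟨e, e', insert a s₁, s₂, .cons hab (by grind) h₁, h₂, ?_,
        Finset.insert_union .., hQ, hP⟩
      rw [Finset.disjoint_insert_left]
      exact ⟨by grind, hd⟩
    · by_cases hab' : Q a ∧ P b
      · exact .inl ⟨a, b, {a}, s, .single a, h, by simpa using ha, rfl, hab'⟩
      · right
        have hac : a ≠ c := fun hac => ha (hac ▸ h.right_mem)
        rw [Finset.erase_insert ha, Finset.erase_insert_of_ne hac, Finset.card_insert_of_notMem ha,
          Finset.filter_insert, ← Finset.insert_erase h.left_mem, Finset.filter_insert,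
          Finset.insert_erase h.left_mem]
        have h1 := Finset.card_insert_le a ((s.erase c).filter Q)
        have h2 := Finset.card_insert_le b ((s.erase b).filter P)
        by_cases hQ : Q a <;> by_cases hP : P b <;> simp only [hQ, hP, if_true, if_false] <;> grind

/-- A path in `H` plus an edge `uv` either avoids `uv` or splits along it. -/
theorem of_sup_edge {u v : V} (h : IsPathOn (G ⊔ edge u v) a b s) :
    IsPathOn G a b s ∨ ∃ s₁ s₂, Disjoint s₁ s₂ ∧ s₁ ∪ s₂ = s ∧
      ((IsPathOn G a u s₁ ∧ IsPathOn G v b s₂) ∨ (IsPathOn G a v s₁ ∧ IsPathOn G u b s₂)) := by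
  induction h with
  | single a => exact .inl (.single a)
  | @cons a b c s hab ha h ih =>
    by_cases hG : G.Adj a b
    · rcases ih with ih | ⟨s₁, s₂, hd, rfl, ih⟩
      · exact .inl (.cons hG ha ih)
      · refine .inr ⟨insert a s₁, s₂, ?_, Finset.insert_union .., ?_⟩
        · rw [Finset.disjoint_insert_left]
          exact ⟨by grind, hd⟩
        · exact ih.imp (fun h' => ⟨.cons hG (by grind) h'.1, h'.2⟩)
            fun h' => ⟨.cons hG (by grind) h'.1, h'.2⟩
    · have hd : Disjoint {a} s := by simpa using ha
      have hab' : (a = u ∧ b = v) ∨ (a = v ∧ b = u) := by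
        simp only [sup_adj, hG, edge_adj] at hab
        grind
      rcases ih with ih | ⟨s₁, s₂, hd', hs, ih⟩
      · rcases hab' with ⟨rfl, rfl⟩ | ⟨rfl, rfl⟩
        · exact .inr ⟨{a}, s, hd, rfl, .inl ⟨.single a, ih⟩⟩
        · exact .inr ⟨{a}, s, hd, rfl, .inr ⟨.single a, ih⟩⟩
      · exfalso
        rcases ih with ⟨h₁, h₂⟩ | ⟨h₁, h₂⟩ <;>
        · have := h₁.right_mem
          have := h₂.left_mem
          grind

end IsPathOn

end

section

variable {V : Type*} [Fintype V] [DecidableEq V]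

theorem IsCycleOn.isHamiltonian {G : SimpleGraph V} (h : IsCycleOn G Finset.univ) :
    G.IsHamiltonian := by
  obtain ⟨hc, a, b, hp, hba⟩ := h
  obtain ⟨p, hp', hs⟩ := hp.exists_walk
  have hlen : p.length = Fintype.card V - 1 :=
    (p.isHamiltonian_iff_isPath_and_length_eq.1
      (hp'.isHamiltonian_iff.2 fun x => by simp [hs])).2
  rw [Finset.card_univ] at hc
  intro _
  refine ⟨b, .cons hba p, Walk.isHamiltonianCycle_iff_isCycle_and_length_eq.2 ⟨?_, ?_⟩⟩
  · rw [Walk.isCycle_iff_isPath_tail_and_le_length]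
    exact ⟨by simpa using hp', by rw [Walk.length_cons]; omega⟩
  · rw [Walk.length_cons]
    omega

theorem IsPathOn.exists_isCycleOn {G H : SimpleGraph V} [DecidableRel G.Adj] (hGH : G ≤ H)
    {u v : V} {s : Finset V} (h : IsPathOn H u v s) (hs : 3 ≤ s.card)
    (huv : Fintype.card V ≤ G.degree u + G.degree v) : ∃ t, s ⊆ t ∧ IsCycleOn H t := by
  rcases h.exists_split_or_card_lt (G.Adj u) (G.Adj v) with
    ⟨c, c', s₁, s₂, h₁, h₂, hd, rfl, hvc, huc⟩ | hlt
  · exact ⟨_, subset_rfl, hs, u, c', h₁.append (hGH hvc.symm) h₂.reverse hd, hGH huc.symm⟩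
  · by_cases hw : ∃ w, w ∉ s ∧ G.Adj u w ∧ G.Adj v w
    · obtain ⟨w, hws, huw, hvw⟩ := hw
      refine ⟨insert w s, Finset.subset_insert .., ?_, w, v, .cons (hGH huw.symm) hws h, hGH hvw⟩
      grind
    · exfalso
      have h1 : (G.neighborFinset u \ s) ∪ (G.neighborFinset v \ s) ⊆ sᶜ := by
        intro w
        simp only [Finset.mem_union, Finset.mem_sdiff, Finset.mem_compl]
        tauto
      have h2 : Disjoint (G.neighborFinset u \ s) (G.neighborFinset v \ s) := by
        rw [Finset.disjoint_left]
        intro w hw1 hw2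
        simp only [Finset.mem_sdiff, mem_neighborFinset] at hw1 hw2
        exact hw ⟨w, hw1.2, hw1.1, hw2.1⟩
      have h3 := Finset.card_le_card h1
      rw [Finset.card_union_of_disjoint h2, Finset.card_compl] at h3
      have h4 : G.neighborFinset u ∩ s = (s.erase u).filter (G.Adj u) := by
        ext w
        simp only [Finset.mem_inter, mem_neighborFinset, Finset.mem_filter, Finset.mem_erase]
        exact ⟨fun h => ⟨⟨h.1.ne', h.2⟩, h.1⟩, fun h => ⟨h.2, h.1.2⟩⟩
      have h5 : G.neighborFinset v ∩ s = (s.erase v).filter (G.Adj v) := by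
        ext w
        simp only [Finset.mem_inter, mem_neighborFinset, Finset.mem_filter, Finset.mem_erase]
        exact ⟨fun h => ⟨⟨h.1.ne', h.2⟩, h.1⟩, fun h => ⟨h.2, h.1.2⟩⟩
      rw [← h4, ← h5] at hlt
      have h6 := Finset.card_sdiff_add_card_inter (G.neighborFinset u) s
      have h7 := Finset.card_sdiff_add_card_inter (G.neighborFinset v) s
      have h8 := s.card_le_univ
      rw [card_neighborFinset_eq_degree] at h6 h7
      omega

/-- One Bondy–Chvátal step: a cycle using the extra edge `uv` can be rerouted. -/
theorem IsCycleOn.of_sup_edge {G H : SimpleGraph V} [DecidableRel G.Adj] (hGH : G ≤ H)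
    {u v : V} {s : Finset V} (h : IsCycleOn (H ⊔ edge u v) s)
    (huv : Fintype.card V ≤ G.degree u + G.degree v) : ∃ t, s ⊆ t ∧ IsCycleOn H t := by
  obtain ⟨hs, a, b, hp, hba⟩ := h
  suffices h : IsCycleOn H s ∨ IsPathOn H u v s by
    exact h.elim (fun h => ⟨s, subset_rfl, h⟩) fun h => h.exists_isCycleOn hGH hs huv
  have hba' : H.Adj b a ∨ (b = u ∧ a = v) ∨ (b = v ∧ a = u) := by
    simp only [sup_adj, edge_adj] at hba
    tauto
  rcases hp.of_sup_edge with hp' | ⟨s₁, s₂, hd, rfl, hp'⟩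
  · rcases hba' with hba | ⟨rfl, rfl⟩ | ⟨rfl, rfl⟩
    · exact .inl ⟨hs, a, b, hp', hba⟩
    · exact .inr hp'.reverse
    · exact .inr hp'
  · rcases hba' with hba | hba'
    · rcases hp' with ⟨h₁, h₂⟩ | ⟨h₁, h₂⟩
      · rw [Finset.union_comm]
        exact .inr (h₂.append hba h₁ hd.symm).reverse
      · rw [Finset.union_comm]
        exact .inr (h₂.append hba h₁ hd.symm)
    · exfalso
      rcases hp' with ⟨h₁, h₂⟩ | ⟨h₁, h₂⟩ <;> rcases hba' with ⟨rfl, rfl⟩ | ⟨rfl, rfl⟩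
      · exact Finset.disjoint_left.1 hd h₁.right_mem h₂.right_mem
      · rw [h₁.eq_singleton, h₂.eq_singleton] at hs
        exact absurd (hs.trans (Finset.card_union_le ..)) (by simp)
      · rw [h₁.eq_singleton, h₂.eq_singleton] at hs
        exact absurd (hs.trans (Finset.card_union_le ..)) (by simp)
      · exact Finset.disjoint_left.1 hd h₁.right_mem h₂.right_mem

/-- `G` together with all pairs of vertices whose degree sum is at least `|V|`. -/
def oreGraph (G : SimpleGraph V) [DecidableRel G.Adj] : SimpleGraph V where
  Adj u v := u ≠ v ∧ (G.Adj u v ∨ Fintype.card V ≤ G.degree u + G.degree v)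
  symm := ⟨fun u v h => ⟨h.1.symm, by rw [G.adj_comm, Nat.add_comm]; exact h.2⟩⟩
  loopless := ⟨fun u h => h.1 rfl⟩

omit [DecidableEq V] in
theorem le_oreGraph (G : SimpleGraph V) [DecidableRel G.Adj] : G ≤ oreGraph G :=
  fun _ _ h => ⟨h.ne, .inl h⟩

theorem IsCycleOn.of_oreGraph {G : SimpleGraph V} [DecidableRel G.Adj] {s : Finset V}
    (h : IsCycleOn (oreGraph G) s) : ∃ t, s ⊆ t ∧ IsCycleOn G t := by
  classical
  suffices H : ∀ E : Finset (V × V),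
      (∀ e ∈ E, Fintype.card V ≤ G.degree e.1 + G.degree e.2) →
      ∀ s, IsCycleOn (G ⊔ fromRel fun x y => (x, y) ∈ E) s → ∃ t, s ⊆ t ∧ IsCycleOn G t by
    refine H (Finset.univ.filter fun e => Fintype.card V ≤ G.degree e.1 + G.degree e.2)
      (by simp) s ?_
    convert h using 1
    ext x y
    simp only [oreGraph, sup_adj, fromRel_adj, Finset.mem_filter, Finset.mem_univ, true_and,
      Nat.add_comm (G.degree y), or_self]
    have := @SimpleGraph.Adj.ne _ G x y
    tauto
  intro E
  induction E using Finset.induction_on with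
  | empty =>
    intro _ s hs
    refine ⟨s, subset_rfl, ?_⟩
    convert hs using 1
    ext x y
    simp
  | insert e E he ih =>
    intro hE s hs
    have hs' : IsCycleOn ((G ⊔ fromRel fun x y => (x, y) ∈ E) ⊔ edge e.1 e.2) s := by
      convert hs using 1
      ext x y
      simp only [sup_adj, fromRel_adj, edge_adj, Finset.mem_insert, Prod.ext_iff]
      tauto
    obtain ⟨t, hst, ht⟩ := hs'.of_sup_edge (G := G) le_sup_left (hE e (by simp))
    obtain ⟨t', htt, ht'⟩ := ih (fun e he => hE e (by simp [he])) t ht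
    exact ⟨t', hst.trans htt, ht'⟩

end
section

variable {V : Type*} [Fintype V] {G : SimpleGraph V}

theorem TwoConnected.reflTransGen (h : TwoConnected G) {v a b : V} (ha : a ≠ v) (hb : b ≠ v) :
    Relation.ReflTransGen (fun x y => G.Adj x y ∧ x ≠ v ∧ y ≠ v) a b := by
  have h' := (h.2 v).preconnected ⟨a, ha⟩ ⟨b, hb⟩
  rw [reachable_iff_reflTransGen] at h'
  exact h'.lift (p := fun x y => G.Adj x y ∧ x ≠ v ∧ y ≠ v) Subtype.val
    (fun x y hxy => ⟨hxy, x.2, y.2⟩)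

theorem exists_rel_of_reflTransGen {α : Type*} {r : α → α → Prop} (p : α → Prop) {a b : α}
    (h : Relation.ReflTransGen r a b) (ha : p a) (hb : ¬p b) : ∃ x y, r x y ∧ p x ∧ ¬p y := by
  induction h with
  | refl => exact absurd ha hb
  | @tail b c _ hbc ih =>
    by_cases hp : p b
    · exact ⟨b, c, hbc, hp, hb⟩
    · exact ih hp

/-- Deleting a vertex other than `w` leaves an edge from any set `p` containing `w` to its
complement. -/
theorem TwoConnected.exists_adj (h : TwoConnected G) (p : V → Prop) {v a b : V} (ha : a ≠ v)
    (hb : b ≠ v) (hpa : p a) (hpb : ¬p b) : ∃ x y, G.Adj x y ∧ x ≠ v ∧ y ≠ v ∧ p x ∧ ¬p y := by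
  obtain ⟨x, y, h1, h2⟩ := exists_rel_of_reflTransGen p (h.reflTransGen ha hb) hpa hpb
  exact ⟨x, y, h1.1, h1.2.1, h1.2.2, h2⟩

variable [DecidableEq V]

theorem TwoConnected.exists_adj_ne (h : TwoConnected G) {p q : V} (hpq : p ≠ q) :
    ∃ w, G.Adj q w ∧ w ≠ p := by
  have : ({p, q} : Finset V).card < Finset.univ.card :=
    Finset.card_le_two.trans_lt h.1
  obtain ⟨b, -, hb⟩ := Finset.exists_mem_notMem_of_card_lt_card this
  simp only [Finset.mem_insert, Finset.mem_singleton, not_or] at hb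
  obtain ⟨x, y, hxy, -, hyp, rfl, -⟩ := h.exists_adj (· = q) hpq.symm hb.1 rfl hb.2
  exact ⟨y, hxy, hyp⟩

theorem TwoConnected.exists_isCycleOn_of_adj (h : TwoConnected G) {p q : V} (hpq : G.Adj p q) :
    ∃ s, p ∈ s ∧ q ∈ s ∧ IsCycleOn G s := by
  obtain ⟨w, hqw, hwp⟩ := h.exists_adj_ne hpq.ne
  obtain ⟨s, hs, hd⟩ := IsPathOn.exists_subset_of_reflTransGen (G := G) (S := {q}) (b := w)
    (by simpa using hpq.ne) (by simpa using h.reflTransGen hpq.ne hqw.ne')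
  have hq : q ∉ s := by simpa using hd
  refine ⟨insert q s, by simp [hs.left_mem], by simp, ?_, q, w, .cons hpq.symm hq hs, hqw.symm⟩
  rw [Finset.card_insert_of_notMem hq]
  have := hs.one_lt_card hwp.symm
  omega

/-- In a 2-connected graph all heavy vertices lie on a common cycle. -/
theorem TwoConnected.exists_isCycleOn_heavy [DecidableRel G.Adj] (h : TwoConnected G) :
    ∃ s, IsCycleOn G s ∧ ∀ x, Heavy G x → x ∈ s := by
  classical
  set S := Finset.univ.filter fun x => Heavy G x with hS
  have hmem : ∀ x, Heavy G x ↔ x ∈ S := by simp [hS]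
  have hedge : ∀ p, S ⊆ {p} → ∃ s, IsCycleOn G s ∧ ∀ x, Heavy G x → x ∈ s := by
    intro p hp
    obtain ⟨r, hr⟩ := Fintype.exists_ne_of_one_lt_card (by have := h.1; omega) p
    obtain ⟨q, hpq, -⟩ := h.exists_adj_ne hr
    obtain ⟨s, hps, -, hs⟩ := h.exists_isCycleOn_of_adj hpq
    refine ⟨s, hs, fun x hx => ?_⟩
    rwa [Finset.mem_singleton.1 (hp ((hmem x).1 hx))]
  rcases lt_trichotomy S.card 2 with hlt | heq | hgt
  · by_cases hne : S.Nonempty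
    · obtain ⟨p, hp⟩ := hne
      exact hedge p fun x hx => Finset.mem_singleton.2
        (Finset.card_le_one.1 (by omega) x hx p hp)
    · have : Nonempty V := Fintype.card_pos_iff.1 (by have := h.1; omega)
      exact hedge (Classical.arbitrary V) (by simp [Finset.not_nonempty_iff_eq_empty.1 hne])
  · obtain ⟨p, q, hpq, hpqS⟩ := Finset.card_eq_two.1 heq
    suffices H : ∃ s, p ∈ s ∧ q ∈ s ∧ IsCycleOn G s by
      obtain ⟨s, hps, hqs, hs⟩ := H
      refine ⟨s, hs, fun x hx => ?_⟩
      rw [hmem, hpqS, Finset.mem_insert, Finset.mem_singleton] at hx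
      rcases hx with rfl | rfl <;> assumption
    by_cases hadj : G.Adj p q
    · exact h.exists_isCycleOn_of_adj hadj
    · have hp : Heavy G p := (hmem p).2 (by simp [hpqS])
      have hq : Heavy G q := (hmem q).2 (by simp [hpqS])
      have hsub : G.neighborFinset p ∪ G.neighborFinset q ⊆ ({p, q} : Finset V)ᶜ := by
        intro x
        simp only [Finset.mem_union, mem_neighborFinset, Finset.mem_compl, Finset.mem_insert,
          Finset.mem_singleton]
        rintro (hx | hx) (rfl | rfl)
        exacts [hx.ne rfl, hadj hx, hadj hx.symm, hx.ne rfl]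
      have h1 := Finset.card_le_card hsub
      have h2 := Finset.card_union_add_card_inter (G.neighborFinset p) (G.neighborFinset q)
      rw [Finset.card_compl, Finset.card_pair hpq] at h1
      rw [card_neighborFinset_eq_degree, card_neighborFinset_eq_degree] at h2
      have h3 := h.1
      unfold Heavy at hp hq
      obtain ⟨x, hx, y, hy, hxy⟩ := Finset.one_lt_card.1
        (show 1 < (G.neighborFinset p ∩ G.neighborFinset q).card by omega)
      simp only [Finset.mem_inter, mem_neighborFinset] at hx hy
      have hyq : IsPathOn G y q {y, q} := .cons hy.2.symm (by simpa using hy.2.ne') (.single q)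
      have hxq : IsPathOn G x q {x, p, y, q} := .cons hx.1.symm
        (by simp [hx.1.ne', hxy, hx.2.ne']) (.cons hy.1 (by simp [hy.1.ne, hpq]) hyq)
      refine ⟨{x, p, y, q}, by simp, by simp, ?_, x, q, hxq, hx.2⟩
      have : ({x, p, q} : Finset V).card = 3 := Finset.card_eq_three.2
        ⟨x, p, q, hx.1.ne', hx.2.ne', hpq, rfl⟩
      rw [← this]
      exact Finset.card_le_card (by grind)
  · have hclique : (oreGraph G).IsClique (S : Set V) := by
      intro x hx y hy hxy
      have hx' := (hmem x).2 hx
      have hy' := (hmem y).2 hy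
      unfold Heavy at hx' hy'
      exact ⟨hxy, .inr (by omega)⟩
    obtain ⟨a, b, hab⟩ := IsPathOn.exists_of_isClique (Finset.card_pos.1 (by omega)) hclique
    have hne : b ≠ a := by
      rintro rfl
      rw [hab.eq_singleton] at hgt
      simp at hgt
    obtain ⟨t, hSt, ht⟩ := IsCycleOn.of_oreGraph
      (show IsCycleOn (oreGraph G) S from ⟨hgt, a, b, hab, hclique hab.right_mem hab.left_mem hne⟩)
    exact ⟨t, ht, fun x hx => hSt ((hmem x).1 hx)⟩

/-- Two distinct vertices of `S` are joined by a path through the complement of `S`. -/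
theorem TwoConnected.exists_ear (h : TwoConnected G) {S : Finset V} (hS : 1 < S.card) {w : V}
    (hw : w ∉ S) : ∃ u v x y X, u ∈ S ∧ v ∈ S ∧ u ≠ v ∧ G.Adj u x ∧ G.Adj v y ∧
      IsPathOn G x y X ∧ Disjoint X S := by
  set r : V → V → Prop := fun x y => G.Adj x y ∧ x ∉ S ∧ y ∉ S with hr
  have : Std.Symm r := ⟨fun x y hxy => ⟨hxy.1.symm, hxy.2.2, hxy.2.1⟩⟩
  have key : ∀ u ∈ S, ∃ v ∈ S, v ≠ u ∧ ∃ y, G.Adj v y ∧ Relation.ReflTransGen r w y := by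
    intro u hu
    obtain ⟨v, hv, hvu⟩ := Finset.exists_mem_ne hS u
    have hmem : ∀ y, Relation.ReflTransGen r w y → y ∉ S := by
      intro y hy
      cases hy with
      | refl => exact hw
      | tail _ h => exact h.2.2
    obtain ⟨y, z, hyz, -, hzu, hy, hz⟩ := h.exists_adj (Relation.ReflTransGen r w ·)
      (fun hwu : w = u => hw (hwu ▸ hu)) hvu .refl fun h' => hmem v h' hv
    refine ⟨z, ?_, hzu, y, hyz.symm, hy⟩
    by_contra hzS
    exact hz (hy.tail ⟨hyz, hmem y hy, hzS⟩)
  obtain ⟨u₀, hu₀⟩ := Finset.card_pos.1 (zero_lt_one.trans hS)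
  obtain ⟨u, hu, -, x, hux, hwx⟩ := key u₀ hu₀
  obtain ⟨v, hv, hvu, y, hvy, hwy⟩ := key u hu
  have hxS : x ∉ S := by
    cases hwx with
    | refl => exact hw
    | tail _ h => exact h.2.2
  obtain ⟨X, hX, hd⟩ := IsPathOn.exists_subset_of_reflTransGen hxS
    ((Relation.ReflTransGen.stdSymm.symm _ _ hwx).trans hwy)
  exact ⟨u, v, x, y, X, hu, hv, hvu.symm, hux, hvy, hX, hd⟩

end
section

variable {V : Type*} [DecidableEq V]

/-- The vertices `u`, `v` cut a cycle with vertex set `S` into a path from `a` to `f` on `A` and a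
path from `e` to `d` on `B`, so that the cycle reads `u, a, …, f, v, e, …, d, u`. -/
structure IsCutCycle (G : SimpleGraph V) (S : Finset V) (u v a f e d : V) (A B : Finset V) :
    Prop where
  pathA : IsPathOn G a f A
  pathB : IsPathOn G e d B
  ua : G.Adj u a
  ud : G.Adj u d
  vf : G.Adj v f
  ve : G.Adj v e
  ne : u ≠ v
  uA : u ∉ A
  uB : u ∉ B
  vA : v ∉ A
  vB : v ∉ B
  disj : Disjoint A B
  eq : S = insert u (insert v (A ∪ B))

/-- A path on `X`, outside `S`, whose ends `x` and `y` are attached to `u` and `v`. -/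
structure IsEar (G : SimpleGraph V) (S : Finset V) (u v x y : V) (X : Finset V) : Prop where
  path : IsPathOn G x y X
  ux : G.Adj u x
  vy : G.Adj v y
  disj : Disjoint X S

variable {G : SimpleGraph V} {S : Finset V} {u v a f e d x y z : V} {A B X Z : Finset V}

theorem IsEar.symm (h : IsEar G S u v x y X) : IsEar G S v u y x X :=
  ⟨h.path.reverse, h.vy, h.ux, h.disj⟩

theorem IsEar.left_notMem (h : IsEar G S u v x y X) : x ∉ S :=
  Finset.disjoint_left.1 h.disj h.path.left_mem

theorem IsCutCycle.swap (h : IsCutCycle G S u v a f e d A B) :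
    IsCutCycle G S v u e d a f B A where
  pathA := h.pathB
  pathB := h.pathA
  ua := h.ve
  ud := h.vf
  vf := h.ud
  ve := h.ua
  ne := h.ne.symm
  uA := h.vB
  uB := h.vA
  vA := h.uB
  vB := h.uA
  disj := h.disj.symm
  eq := by rw [h.eq, Finset.insert_comm, Finset.union_comm]

theorem IsCutCycle.rev (h : IsCutCycle G S u v a f e d A B) :
    IsCutCycle G S u v d e f a B A where
  pathA := h.pathB.reverse
  pathB := h.pathA.reverse
  ua := h.ud
  ud := h.ua
  vf := h.ve
  ve := h.vf
  ne := h.ne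
  uA := h.uB
  uB := h.uA
  vA := h.vB
  vB := h.vA
  disj := h.disj.symm
  eq := by rw [h.eq, Finset.union_comm]

namespace IsCutCycle

theorem ne_ad (h : IsCutCycle G S u v a f e d A B) : a ≠ d := fun had =>
  Finset.disjoint_left.1 h.disj h.pathA.left_mem (had ▸ h.pathB.right_mem)

theorem ne_ae (h : IsCutCycle G S u v a f e d A B) : a ≠ e := fun hae =>
  Finset.disjoint_left.1 h.disj h.pathA.left_mem (hae ▸ h.pathB.left_mem)

theorem ne_va (h : IsCutCycle G S u v a f e d A B) : v ≠ a := fun hva =>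
  h.vA (hva ▸ h.pathA.left_mem)

theorem a_mem (h : IsCutCycle G S u v a f e d A B) : a ∈ S := by
  rw [h.eq]
  simp [h.pathA.left_mem]

theorem v_mem (h : IsCutCycle G S u v a f e d A B) : v ∈ S := by
  rw [h.eq]
  simp

end IsCutCycle

end

section

variable {V : Type*} [Fintype V]

/-- Every pair of vertices at distance 2 within an induced `Z₂` contains a heavy vertex. -/
def Z2Heavy (G : SimpleGraph V) [DecidableRel G.Adj] : Prop :=
  ∀ a1 a2 a3 b1 c1 : V, IsInducedZ2 G a1 a2 a3 b1 c1 →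
    (Fintype.card V ≤ 2 * G.degree a2 ∨ Fintype.card V ≤ 2 * G.degree b1) ∧
    (Fintype.card V ≤ 2 * G.degree a3 ∨ Fintype.card V ≤ 2 * G.degree b1) ∧
    (Fintype.card V ≤ 2 * G.degree a1 ∨ Fintype.card V ≤ 2 * G.degree c1)

theorem lt_of_not_oreGraph_adj {G : SimpleGraph V} [DecidableRel G.Adj] {u v : V} (hne : u ≠ v)
    (h : ¬(oreGraph G).Adj u v) :
    G.degree u + G.degree v < Fintype.card V := by
  by_contra h'
  exact h ⟨hne, .inr (not_lt.1 h')⟩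

variable [DecidableEq V]

/-- No cycle of `oreGraph G` extends `S`, and `S` contains all heavy vertices. -/
structure IsMaxCycleSet (G : SimpleGraph V) [DecidableRel G.Adj] (S : Finset V) : Prop where
  card : 3 ≤ S.card
  max : ∀ T, IsCycleOn (oreGraph G) T → S ⊆ T → T ⊆ S
  heavy : ∀ x, Heavy G x → x ∈ S

variable {G : SimpleGraph V} [DecidableRel G.Adj] {S : Finset V} {u v a f e d x y z : V}
  {A B X Z : Finset V}

theorem IsMaxCycleSet.not_extend (hS : IsMaxCycleSet G S) {T : Finset V} {p q w : V}
    (hT : IsPathOn (oreGraph G) p q T) (hqp : (oreGraph G).Adj q p) (hST : S ⊆ T) (hwT : w ∈ T)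
    (hwS : w ∉ S) : False :=
  hwS (hS.max T ⟨hS.card.trans (Finset.card_le_card hST), p, q, hT, hqp⟩ hST hwT)

theorem IsMaxCycleSet.not_heavy (hS : IsMaxCycleSet G S) (hx : x ∉ S) :
    ¬Fintype.card V ≤ 2 * G.degree x :=
  fun h => hx (hS.heavy x h)

theorem IsMaxCycleSet.exists_isCutCycle (hS : IsMaxCycleSet G S) (hC : IsCycleOn G S)
    (hX : IsEar G S u v x y X) (hu : u ∈ S) (hv : v ∈ S) (huv : u ≠ v) :
    ∃ a f e d A B, IsCutCycle G S u v a f e d A B := by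
  obtain ⟨-, p, q, hpq, hqp⟩ := hC
  have hrot : ∃ d, IsPathOn G u d S ∧ G.Adj d u := by
    by_cases hup : u = p
    · subst hup
      exact ⟨q, hpq, hqp⟩
    · obtain ⟨c, s₁, s₂, h₁, hcu, h₂, hd, rfl⟩ := hpq.split_at hu hup
      refine ⟨c, ?_, hcu⟩
      rw [Finset.union_comm]
      exact h₂.append hqp h₁ hd.symm
  obtain ⟨d, hud, hdu⟩ := hrot
  obtain ⟨f, s₁, s₂, h₁, hfv, h₂, hd, rfl⟩ := hud.split_at hv huv.symm
  have hH := le_oreGraph G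
  have hX1 := (Finset.disjoint_union_right.1 hX.disj).1
  have hX2 := (Finset.disjoint_union_right.1 hX.disj).2
  rcases h₁.uncons with ⟨rfl, rfl⟩ | ⟨a, A, hua, hA, huA, rfl⟩
  · refine (hS.not_extend (w := x) (((hX.path.append hX.vy.symm h₂ hX2).append hdu
      (.single _) ?_).mono hH) (hH hX.ux) ?_ ?_ hX.left_notMem).elim
    · rw [Finset.disjoint_union_left]
      exact ⟨hX1, hd.symm⟩
    · grind
    · simp [hX.path.left_mem]
  · rcases h₂.uncons with ⟨rfl, rfl⟩ | ⟨e, B, hve, hB, hvB, rfl⟩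
    · refine (hS.not_extend (w := x) (((h₁.append hfv (.single _) hd).append hX.vy
        hX.path.reverse ?_).mono hH) (hH hX.ux.symm) ?_ ?_ hX.left_notMem).elim
      · exact hX.disj.symm
      · grind
      · simp [hX.path.left_mem]
    · refine ⟨a, f, e, d, A, B, hA, hB, hua, hdu.symm, hfv.symm, hve, huv, huA, ?_, ?_, hvB, ?_, ?_⟩
      all_goals grind [Finset.disjoint_left]

namespace IsCutCycle

theorem not_adj_ae (h : IsCutCycle G S u v a f e d A B) (hS : IsMaxCycleSet G S)
    (hX : IsEar G S u v x y X) : ¬(oreGraph G).Adj a e := by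
  intro hae
  have hH := le_oreGraph G
  obtain ⟨hA, hB, hua, hud, hvf, hve, hne, huA, huB, hvA, hvB, hd, hSeq⟩ := h
  have hXS := hX.disj
  refine hS.not_extend (w := x) ((hX.path.mono hH).append (hH hX.vy.symm)
    ((((IsPathOn.cons hvf hvA hA.reverse).mono hH).append hae (hB.mono hH) ?_).append
      (hH hud.symm) (.single u) ?_) ?_) (hH hX.ux) ?_ ?_ hX.left_notMem
  · grind [Finset.disjoint_left]
  · grind [Finset.disjoint_left]
  · grind [Finset.disjoint_left]
  · grind
  · simp [hX.path.left_mem]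

theorem not_adj_df (h : IsCutCycle G S u v a f e d A B) (hS : IsMaxCycleSet G S)
    (hX : IsEar G S u v x y X) : ¬(oreGraph G).Adj d f :=
  h.rev.not_adj_ae hS hX

/-- A vertex reached from `u` through the complement of `S` is not adjacent to `a`. -/
theorem not_adj_za (h : IsCutCycle G S u v a f e d A B) (hS : IsMaxCycleSet G S)
    (hZ : IsPathOn G x z Z) (hux : G.Adj u x) (hZS : Disjoint Z S) :
    ¬(oreGraph G).Adj z a := by
  intro hza
  have hH := le_oreGraph G
  obtain ⟨hA, hB, hua, hud, hvf, hve, hne, huA, huB, hvA, hvB, hd, hSeq⟩ := h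
  refine hS.not_extend (w := x) ((hZ.mono hH).append hza
    (((hA.append hvf.symm (.cons hve hvB hB) ?_).append hud.symm (.single u) ?_).mono hH) ?_)
    (hH hux) ?_ ?_ (Finset.disjoint_left.1 hZS hZ.left_mem)
  · grind [Finset.disjoint_left]
  · grind [Finset.disjoint_left]
  · grind [Finset.disjoint_left]
  · grind
  · simp [hZ.left_mem]

theorem not_adj_zd (h : IsCutCycle G S u v a f e d A B) (hS : IsMaxCycleSet G S)
    (hZ : IsPathOn G x z Z) (hux : G.Adj u x) (hZS : Disjoint Z S) :
    ¬(oreGraph G).Adj z d :=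
  h.rev.not_adj_za hS hZ hux hZS

theorem not_adj_xa (h : IsCutCycle G S u v a f e d A B) (hS : IsMaxCycleSet G S)
    (hX : IsEar G S u v x y X) : ¬(oreGraph G).Adj x a :=
  h.not_adj_za hS (.single x) hX.ux (by simpa using hX.left_notMem)

theorem adj_ad (h : IsCutCycle G S u v a f e d A B) (hS : IsMaxCycleSet G S)
    (ho : OHeavy G) (hX : IsEar G S u v x y X) : (oreGraph G).Adj a d := by
  by_contra had
  have hH := le_oreGraph G
  have hxa := h.not_adj_xa hS hX
  have hxd := h.rev.not_adj_xa hS hX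
  have hne : x ≠ a := fun h' => hX.left_notMem (h' ▸ h.a_mem)
  have hne' : x ≠ d := fun h' => hX.left_notMem (h' ▸ h.rev.a_mem)
  have h1 := lt_of_not_oreGraph_adj hne hxa
  have h2 := lt_of_not_oreGraph_adj hne' hxd
  have h3 := lt_of_not_oreGraph_adj h.ne_ad had
  have := ho u x a d ⟨hne, hne', h.ne_ad, hX.ux, h.ua, h.ud, fun h => hxa (hH h),
    fun h => hxd (hH h), fun h => had (hH h)⟩
  omega

theorem not_adj_ue (h : IsCutCycle G S u v a f e d A B) (hS : IsMaxCycleSet G S)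
    (ho : OHeavy G) (hX : IsEar G S u v x y X) : ¬(oreGraph G).Adj u e := by
  intro hue
  have hH := le_oreGraph G
  have had := h.adj_ad hS ho hX
  obtain ⟨hA, hB, hua, hud, hvf, hve, hne, huA, huB, hvA, hvB, hd, hSeq⟩ := h
  have hXS := hX.disj
  refine hS.not_extend (w := x) ((((hX.path.append hX.vy.symm
    (.cons hvf hvA hA.reverse) ?_).mono hH).append had (hB.reverse.mono hH) ?_).append
      hue.symm (.single u) ?_) (hH hX.ux) ?_ ?_ hX.left_notMem
  · grind [Finset.disjoint_left]
  · grind [Finset.disjoint_left]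
  · grind [Finset.disjoint_left]
  · grind
  · simp [hX.path.left_mem]

theorem heavy_of_adj_ad (h : IsCutCycle G S u v a f e d A B) (hS : IsMaxCycleSet G S)
    (hZ : Z2Heavy G) (hX : IsEar G S u v x y X) (had : G.Adj a d) {c : V} (hxc : G.Adj x c)
    (hcu : c ≠ u) (hca : c ≠ a) (hcd : c ≠ d) (huc : ¬G.Adj c u) (hac : ¬G.Adj c a)
    (hdc : ¬G.Adj c d) : Heavy G a ∧ Heavy G d := by
  have hH := le_oreGraph G
  have hx := hX.left_notMem
  have := hZ u a d x c ⟨h.ua, h.ud, had, hX.ux, hxc, fun h' => hx (h' ▸ h.a_mem),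
    fun h' => hx (h' ▸ h.rev.a_mem), hcu, hca, hcd, fun h' => h.not_adj_xa hS hX (hH h'),
    fun h' => h.rev.not_adj_xa hS hX (hH h'), huc, hac, hdc⟩
  have hx' := hS.not_heavy hx
  exact ⟨this.1.resolve_right hx', this.2.1.resolve_right hx'⟩

theorem false_of_heavy (h : IsCutCycle G S u v a f e d A B) (hS : IsMaxCycleSet G S)
    (ho : OHeavy G) (hX : IsEar G S u v x y X) (h1 : G.Adj a d → Heavy G a ∧ Heavy G d)
    (h2 : G.Adj e f → Heavy G e ∧ Heavy G f) : False := by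
  have hae := lt_of_not_oreGraph_adj h.ne_ae (h.not_adj_ae hS hX)
  have hdf := lt_of_not_oreGraph_adj h.rev.ne_ae (h.not_adj_df hS hX)
  have h1' := (h.adj_ad hS ho hX).2
  have h2' := (h.swap.adj_ad hS ho hX.symm).2
  unfold Heavy at h1 h2
  rcases h1' with h1' | h1' <;> rcases h2' with h2' | h2'
  · have := h1 h1'
    have := h2 h2'
    omega
  · have := h1 h1'
    omega
  · have := h2 h2'
    omega
  · omega

/-- If the ear is as short as possible, and not a triangle over `uv`, then `a` and `d` are heavy
when adjacent. -/
theorem heavy_of_minimal (h : IsCutCycle G S u v a f e d A B) (hS : IsMaxCycleSet G S)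
    (ho : OHeavy G) (hZ : Z2Heavy G) (hX : IsEar G S u v x y X)
    (hmin : ∀ x' X', IsEar G S u v x' y X' → X.card ≤ X'.card)
    (huv : ¬(X = {x} ∧ G.Adj u v)) (had : G.Adj a d) : Heavy G a ∧ Heavy G d := by
  have hH := le_oreGraph G
  rcases hX.path.uncons with ⟨rfl, rfl⟩ | ⟨c, X', hxc, hX', hxX', rfl⟩
  · exact h.heavy_of_adj_ad hS hZ hX had hX.vy.symm h.ne.symm h.ne_va h.rev.ne_va
      (fun h' => huv ⟨rfl, h'.symm⟩) (fun h' => h.swap.not_adj_ue hS ho hX.symm (hH h'))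
      (fun h' => h.swap.rev.not_adj_ue hS ho hX.symm (hH h'))
  · have hd := Finset.disjoint_insert_left.1 hX.disj
    have hcS : c ∉ S := Finset.disjoint_left.1 hd.2 hX'.left_mem
    have hxc' : IsPathOn G x c {x, c} := .cons hxc (by simpa using hxc.ne) (.single c)
    have hxcS : Disjoint {x, c} S := by simp [hd.1, hcS]
    refine h.heavy_of_adj_ad hS hZ hX had hxc (fun h' => hcS (h' ▸ h.swap.v_mem))
      (fun h' => hcS (h' ▸ h.a_mem)) (fun h' => hcS (h' ▸ h.rev.a_mem)) (fun h' => ?_)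
      (fun h' => h.not_adj_za hS hxc' hX.ux hxcS (hH h'))
      (fun h' => h.not_adj_zd hS hxc' hX.ux hxcS (hH h'))
    have := hmin c X' ⟨hX', h'.symm, hX.vy, hd.2⟩
    rw [Finset.card_insert_of_notMem hxX'] at this
    omega

/-- Moving `u` along `A`, the second vertex `b` of `A` can be made nonadjacent to `u`. -/
theorem exists_rotate (h : IsCutCycle G S u v a f e d A B) (hS : IsMaxCycleSet G S)
    (ho : OHeavy G) (hX : IsEar G S u v x y X) (had : G.Adj a d) :
    ∃ a' b d' A' B', IsCutCycle G S u v a' f e d' (insert a' A') B' ∧ G.Adj a' d' ∧ a' ∉ A' ∧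
      G.Adj a' b ∧ IsPathOn G b f A' ∧ ¬G.Adj u b := by
  induction hn : A.card using Nat.strong_induction_on generalizing a d A B with
  | _ n ih =>
    subst hn
    rcases h.pathA.uncons with ⟨rfl, rfl⟩ | ⟨b, A', hab, hA', haA', rfl⟩
    · exact absurd (le_oreGraph G h.ua) (h.rev.not_adj_ue hS ho hX)
    · by_cases hub : G.Adj u b
      · obtain ⟨hA, hB, hua, hud, hvf, hve, hne, huA, huB, hvA, hvB, hd, hSeq⟩ := h
        have h' : IsCutCycle G S u v b f e a A' (B ∪ {a}) := by
          refine ⟨hA', hB.append had.symm (.single a) ?_, hub, hua, hvf, hve, hne, ?_, ?_, ?_, ?_,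
            ?_, ?_⟩
          all_goals grind [Finset.disjoint_left]
        refine ih A'.card ?_ h' hab.symm rfl
        rw [Finset.card_insert_of_notMem haA']
        omega
      · exact ⟨a, b, d, A', B, h, had, haA', hab, hA', hub⟩

theorem exists_heavy_rotate (h : IsCutCycle G S u v a f e d A B) (hS : IsMaxCycleSet G S)
    (ho : OHeavy G) (hZ : Z2Heavy G) (hX : IsEar G S u v x x {x}) (huv : G.Adj u v)
    (had : G.Adj a d) :
    ∃ a' d' A' B', IsCutCycle G S u v a' f e d' A' B' ∧ G.Adj a' d' ∧ Heavy G a' := by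
  obtain ⟨a, b, d, A, B, h, had, haA, hab, hbf, hub⟩ := h.exists_rotate hS ho hX had
  refine ⟨a, d, _, B, h, had, ?_⟩
  have hH := le_oreGraph G
  have hx := hX.left_notMem
  have hef := h.swap.adj_ad hS ho hX.symm
  have hbS : b ∈ S := by
    rw [h.eq]
    simp [hbf.left_mem]
  have hxa := h.not_adj_xa hS hX
  have hva := h.swap.not_adj_ue hS ho hX.symm
  have huf := h.rev.not_adj_ue hS ho hX
  have hne_va := h.ne_va
  have ha := h.a_mem
  obtain ⟨hA, hB, hua, hud, hvf, hve, hne, huA, huB, hvA, hvB, hd, hSeq⟩ := h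
  have hxb : ¬G.Adj x b := by
    intro hxb
    refine hS.not_extend (w := x) ((((IsPathOn.cons hxb (s := A) ?_ hbf).append hvf.symm
      (.cons hve hvB hB) ?_).append had.symm (.cons hua.symm ?_ (.single u)) ?_).mono hH)
      (hH hX.ux) ?_ ?_ hx
    all_goals grind [Finset.disjoint_left]
  have hvb : ¬G.Adj v b := by
    intro hvb
    refine hS.not_extend (w := x) (((((IsPathOn.single x).append hX.vy.symm
      (.cons hvb ?_ hbf) ?_).mono hH).append hef.symm (hB.mono hH) ?_).append (hH had.symm)
      ((IsPathOn.cons hua.symm ?_ (.single u)).mono hH) ?_) (hH hX.ux) ?_ ?_ hx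
    all_goals grind [Finset.disjoint_left]
  have := (hZ u x v a b ⟨hX.ux, huv, hX.vy.symm, hua, hab, fun h' => hx (h' ▸ ha), hne_va.symm,
    fun h' => huA (by simp [← h', hbf.left_mem]), fun h' => hx (h' ▸ hbS),
    fun h' => hvA (by simp [← h', hbf.left_mem]), fun h' => hxa (hH h'.symm),
    fun h' => hva (hH h'.symm), fun h' => hub h'.symm, fun h' => hxb h'.symm,
    fun h' => hvb h'.symm⟩).1
  exact this.resolve_left (hS.not_heavy hx)

theorem not_heavy_of_adj_ad (h : IsCutCycle G S u v a f e d A B) (hS : IsMaxCycleSet G S)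
    (ho : OHeavy G) (hZ : Z2Heavy G) (hX : IsEar G S u v x x {x}) (huv : G.Adj u v)
    (had : G.Adj a d) : ¬Heavy G e := by
  intro he
  obtain ⟨a', d', A', B', h', -, ha'⟩ := h.exists_heavy_rotate hS ho hZ hX huv had
  have := lt_of_not_oreGraph_adj h'.ne_ae (h'.not_adj_ae hS hX)
  unfold Heavy at he ha'
  omega

theorem not_adj_ad_of_triangle (h : IsCutCycle G S u v a f e d A B) (hS : IsMaxCycleSet G S)
    (ho : OHeavy G) (hZ : Z2Heavy G) (hX : IsEar G S u v x x {x}) (huv : G.Adj u v) :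
    ¬G.Adj a d := by
  intro had
  have he := h.not_heavy_of_adj_ad hS ho hZ hX huv had
  have hf := h.rev.not_heavy_of_adj_ad hS ho hZ hX huv had.symm
  obtain ⟨a', d', A', B', h', had', ha'⟩ := h.exists_heavy_rotate hS ho hZ hX huv had
  refine h'.swap.not_heavy_of_adj_ad hS ho hZ hX.symm huv.symm ?_ ha'
  refine (h'.swap.adj_ad hS ho hX.symm).2.resolve_right fun hef => ?_
  unfold Heavy at he hf
  omega

end IsCutCycle

theorem IsMaxCycleSet.not_isEar (hS : IsMaxCycleSet G S) (hC : IsCycleOn G S) (ho : OHeavy G)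
    (hZ : Z2Heavy G) (hu : u ∈ S) (hv : v ∈ S) (huv : u ≠ v) : ¬IsEar G S u v x y X := by
  intro hX
  induction hn : X.card using Nat.strong_induction_on generalizing x y X with
  | _ n ih =>
    subst hn
    have hmin : ∀ x' y' X', IsEar G S u v x' y' X' → X.card ≤ X'.card := fun x' y' X' hX' => by
      by_contra hlt
      exact ih _ (not_le.1 hlt) hX' rfl
    obtain ⟨a, f, e, d, A, B, h⟩ := hS.exists_isCutCycle hC hX hu hv huv
    by_cases htri : X = {x} ∧ G.Adj u v
    · obtain ⟨rfl, hadj⟩ := htri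
      obtain rfl : y = x := Finset.mem_singleton.1 hX.path.right_mem
      exact h.false_of_heavy hS ho hX
        (fun had => absurd had (h.not_adj_ad_of_triangle hS ho hZ hX hadj))
        fun hef => absurd hef (h.swap.not_adj_ad_of_triangle hS ho hZ hX.symm hadj.symm)
    · refine h.false_of_heavy hS ho hX
        (h.heavy_of_minimal hS ho hZ hX (fun x' X' => hmin x' y X') htri)
        (h.swap.heavy_of_minimal hS ho hZ hX.symm (fun y' X' hX' => hmin x y' X' hX'.symm) ?_)
      rintro ⟨rfl, hadj⟩
      exact htri ⟨by rw [Finset.mem_singleton.1 hX.path.left_mem], hadj.symm⟩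

end

/-- **Ning–Zhang theorem.** Let `G` be a 2-connected o-heavy graph. If every pair
of vertices at distance 2 within an induced copy `H` of `Z₂` (namely the pairs
`{a₂,b₁}`, `{a₃,b₁}` and `{a₁,c₁}`) satisfies Fan's condition in `G`, then `G`
is Hamiltonian. -/
theorem ning_zhang {V : Type*} [Fintype V] [DecidableEq V]
    (G : SimpleGraph V) [DecidableRel G.Adj]
    (h2 : TwoConnected G)
    (hheavy : OHeavy G)
    (h : ∀ a1 a2 a3 b1 c1 : V, IsInducedZ2 G a1 a2 a3 b1 c1 →
      (Fintype.card V ≤ 2 * G.degree a2 ∨ Fintype.card V ≤ 2 * G.degree b1) ∧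
      (Fintype.card V ≤ 2 * G.degree a3 ∨ Fintype.card V ≤ 2 * G.degree b1) ∧
      (Fintype.card V ≤ 2 * G.degree a1 ∨ Fintype.card V ≤ 2 * G.degree c1)) :
    G.IsHamiltonian := by
  classical
  obtain ⟨s₀, hs₀, hheavy₀⟩ := h2.exists_isCycleOn_heavy
  obtain ⟨S, hS, hSmax⟩ := Finset.exists_max_image
    (Finset.univ.filter fun s => IsCycleOn G s ∧ ∀ x, Heavy G x → x ∈ s) Finset.card
    ⟨s₀, by simpa using ⟨hs₀, hheavy₀⟩⟩
  simp only [Finset.mem_filter, Finset.mem_univ, true_and] at hS hSmax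
  have hM : IsMaxCycleSet G S := by
    refine ⟨hS.1.1, fun T hT hST => ?_, hS.2⟩
    obtain ⟨t, hTt, ht⟩ := hT.of_oreGraph
    have := Finset.eq_of_subset_of_card_le (hST.trans hTt)
      (hSmax t ⟨ht, fun x hx => hTt (hST (hS.2 x hx))⟩)
    exact this ▸ hTt
  by_cases hall : ∃ w, w ∉ S
  · obtain ⟨w, hw⟩ := hall
    obtain ⟨u, v, x, y, X, hu, hv, huv, hux, hvy, hX, hd⟩ :=
      h2.exists_ear (S := S) (by have := hS.1.1; omega) hw
    exact (hM.not_isEar hS.1 hheavy h hu hv huv ⟨hX, hux, hvy, hd⟩).elim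
  · push Not at hall
    rw [Finset.eq_univ_iff_forall.2 hall] at hS
    exact hS.1.isHamiltonian
end

section
/- Let G be a 2-connected o-heavy graph on n vertices. If for every induced copy H of Z_2 in G and every pair of vertices u, v at distance 2 within H, either max{deg_G(u), deg_G(v)} ≥ n/2 or |N_G(u) ∩ N_G(v)| ≥ 2, then G is Hamiltonian. -/
open SimpleGraph

section OreCycles

variable {V : Type*} (G : SimpleGraph V) [DecidableRel G.Adj]

/-- The cost of a step of an o-path: `0` along an edge, `1` otherwise. -/
def stepCost (a b : V) : ℕ := if G.Adj a b then 0 else 1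

variable {G}

lemma stepCost_comm (a b : V) : stepCost G a b = stepCost G b a := by
  simp [stepCost, G.adj_comm]

lemma stepCost_of_adj {a b : V} (h : G.Adj a b) : stepCost G a b = 0 := by
  simp [stepCost, h]

lemma adj_of_stepCost {a b : V} (h : stepCost G a b = 0) : G.Adj a b := by
  by_contra hn
  simp [stepCost, hn] at h

variable [Fintype V] (G)

/-- Two vertices are o-adjacent if they are adjacent or have degree sum at least `|V|`. -/
def OAdj (a b : V) : Prop :=
  G.Adj a b ∨ Fintype.card V ≤ G.degree a + G.degree b

/-- `OPath G a S b k`: there is a sequence of o-adjacent vertices from `a` to `b` whose multiset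
of vertices is `S` and which has exactly `k` steps that are not edges. -/
inductive OPath : V → Multiset V → V → ℕ → Prop
  | single (a : V) : OPath a {a} a 0
  | cons {a b e : V} {S : Multiset V} {k : ℕ} (hab : OAdj G a b) (h : OPath b S e k) :
      OPath a ({a} + S) e (stepCost G a b + k)

/-- A path in `G` from `a` to `b` with vertex multiset `S`. -/
abbrev GPath (a : V) (S : Multiset V) (b : V) : Prop := OPath G a S b 0

/-- An o-path from `a` to `b` with vertex multiset `S`. -/
def HPath (a : V) (S : Multiset V) (b : V) : Prop := ∃ k, OPath G a S b k

variable {G}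

lemma OAdj.symm {a b : V} (h : OAdj G a b) : OAdj G b a :=
  h.imp (fun h => h.symm) (fun h => by omega)

namespace OPath

lemma join {a b c d : V} {S T : Multiset V} {k m : ℕ} (h₁ : OPath G a S b k)
    (hbc : OAdj G b c) (h₂ : OPath G c T d m) :
    OPath G a (S + T) d (k + stepCost G b c + m) := by
  induction h₁ with
  | single a => simpa using OPath.cons hbc h₂
  | cons hab _ ih => simpa [add_assoc] using OPath.cons hab (ih hbc)

lemma symm {a b : V} {S : Multiset V} {k : ℕ} (h : OPath G a S b k) : OPath G b S a k := by
  induction h with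
  | single a => exact .single a
  | @cons a b e S k hab _ ih =>
    have := ih.join hab.symm (.single a)
    rwa [add_zero, add_comm k, stepCost_comm b a, add_comm S] at this

lemma start_mem {a b : V} {S : Multiset V} {k : ℕ} (h : OPath G a S b k) : a ∈ S := by
  cases h <;> simp

lemma end_mem {a b : V} {S : Multiset V} {k : ℕ} (h : OPath G a S b k) : b ∈ S :=
  h.symm.start_mem

lemma exists_first {P : V → Prop} {a b : V} {S : Multiset V} {k : ℕ} (h : OPath G a S b k)
    (ha : P a) (hS : ∃ t ∈ S, ¬P t) :
    ∃ S₁ S₂ g e k₁ k₂, OPath G a S₁ g k₁ ∧ OAdj G g e ∧ OPath G e S₂ b k₂ ∧ S = S₁ + S₂ ∧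
      k = k₁ + stepCost G g e + k₂ ∧ (∀ t ∈ S₁, P t) ∧ ¬P e := by
  induction h with
  | single a => simp [ha] at hS
  | @cons a b e S k hab h ih =>
    by_cases hb : P b
    · have hS' : ∃ t ∈ S, ¬P t := by
        obtain ⟨t, ht, hPt⟩ := hS
        rcases Multiset.mem_add.1 ht with ht | ht
        · rw [Multiset.mem_singleton.1 ht] at hPt
          exact absurd ha hPt
        · exact ⟨t, ht, hPt⟩
      obtain ⟨S₁, S₂, g, f, k₁, k₂, h₁, hgf, h₂, rfl, rfl, hall, hf⟩ := ih hb hS'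
      refine ⟨{a} + S₁, S₂, g, f, _, _, .cons hab h₁, hgf, h₂, by abel, by omega, ?_, hf⟩
      intro t ht
      rcases Multiset.mem_add.1 ht with ht | ht
      · rwa [Multiset.mem_singleton.1 ht]
      · exact hall t ht
    · exact ⟨{a}, S, a, b, 0, k, .single a, hab, h, rfl, by omega, by simpa using ha, hb⟩

lemma exists_nonedge {a b : V} {S : Multiset V} {k : ℕ} (h : OPath G a S b (k + 1)) :
    ∃ S₁ S₂ g e k₁ k₂, OPath G a S₁ g k₁ ∧ Fintype.card V ≤ G.degree g + G.degree e ∧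
      OPath G e S₂ b k₂ ∧ S = S₁ + S₂ ∧ k = k₁ + k₂ := by
  generalize hm : k + 1 = m at h
  induction h generalizing k with
  | single a => omega
  | @cons a b e S m hab h ih =>
    by_cases hadj : G.Adj a b
    · obtain ⟨S₁, S₂, g, f, k₁, k₂, h₁, hgf, h₂, rfl, rfl⟩ :=
        ih (k := k) (by rw [hm, stepCost_of_adj hadj, zero_add])
      refine ⟨{a} + S₁, S₂, g, f, _, _, .cons hab h₁, hgf, h₂, by abel, ?_⟩
      rw [stepCost_of_adj hadj, zero_add]
    · refine ⟨{a}, S, a, b, 0, m, .single a, hab.resolve_left hadj, h, rfl, ?_⟩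
      simp [stepCost, hadj] at hm
      omega

/-- Either an o-path ending in `b` has a step `g, e` with `g` adjacent to `b` and `e` adjacent to
`a`, or the neighbours of `a` and `b` on it can be bounded. -/
lemma crossing_or_count_le (a : V) {c b : V} {S : Multiset V} {k : ℕ} (h : OPath G c S b k) :
    (∃ S₁ S₂ g e k₁ k₂ j, OPath G c S₁ g k₁ ∧ OPath G e S₂ b k₂ ∧ S = S₁ + S₂ ∧
      k = k₁ + j + k₂ ∧ G.Adj b g ∧ G.Adj a e) ∨
    S.countP (G.Adj b) + S.countP (G.Adj a) + 1 ≤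
      Multiset.card S + if G.Adj a c then 1 else 0 := by
  induction h with
  | single b =>
    right
    simp [← Multiset.cons_zero, Multiset.countP_cons]
  | @cons c d b S k hcd h ih =>
    rcases ih with ⟨S₁, S₂, g, e, k₁, k₂, j, h₁, h₂, rfl, rfl, hg, he⟩ | ih
    · exact .inl ⟨{c} + S₁, S₂, g, e, _, _, j, .cons hcd h₁, h₂, by abel, by omega, hg, he⟩
    · by_cases hx : G.Adj b c ∧ G.Adj a d
      · exact .inl ⟨{c}, S, c, d, 0, k, stepCost G c d, .single c, h, rfl, by omega, hx.1, hx.2⟩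
      · right
        rw [Multiset.singleton_add, Multiset.countP_cons, Multiset.countP_cons,
          Multiset.card_cons]
        by_cases h1 : G.Adj b c <;> by_cases h2 : G.Adj a d <;> by_cases h3 : G.Adj a c <;>
          simp_all <;> omega

end OPath

lemma degree_eq_countP (a : V) : G.degree a = (Finset.univ : Finset V).val.countP (G.Adj a) := by
  rw [Multiset.countP_eq_card_filter, ← G.card_neighborFinset_eq_degree,
    G.neighborFinset_eq_filter]
  rfl

lemma countP_add_countP_le {P Q : V → Prop} [DecidablePred P] [DecidablePred Q] (S : Multiset V)
    (h : ∀ t ∈ S, ¬(P t ∧ Q t)) : S.countP P + S.countP Q ≤ Multiset.card S := by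
  induction S using Multiset.induction with
  | empty => simp
  | cons t S ih =>
    have h1 := ih fun t ht => h t (Multiset.mem_cons_of_mem ht)
    have h2 := h t (Multiset.mem_cons_self t S)
    rw [Multiset.countP_cons, Multiset.countP_cons, Multiset.card_cons]
    split_ifs <;> first | omega | tauto

/-- `S` is the vertex multiset of a closed o-path with `k` steps that are not edges. -/
def OCycleCost (G : SimpleGraph V) [DecidableRel G.Adj] (S : Multiset V) (k : ℕ) : Prop :=
  ∃ a b m, OPath G a S b m ∧ OAdj G b a ∧ k = m + stepCost G b a

/-- An o-path whose ends have degree sum at least `|V|` can be closed up at no cost. -/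
lemma OPath.exists_cycle {a b : V} {S : Multiset V} {k : ℕ} (h : OPath G a S b k)
    (hS : S.Nodup) (hab : Fintype.card V ≤ G.degree a + G.degree b) :
    ∃ S' k', S ≤ S' ∧ S'.Nodup ∧ k' ≤ k ∧ OCycleCost G S' k' := by
  by_cases hout : ∃ w, w ∉ S ∧ G.Adj a w ∧ G.Adj b w
  · obtain ⟨w, hw, haw, hbw⟩ := hout
    refine ⟨S + {w}, k, Multiset.le_add_right _ _, ?_, le_rfl, a, w, k, ?_, .inl haw.symm, ?_⟩
    · rw [add_comm, Multiset.singleton_add]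
      exact Multiset.nodup_cons.2 ⟨hw, hS⟩
    · simpa [stepCost_of_adj hbw] using h.join (.inl hbw) (.single w)
    · simp [stepCost_of_adj haw.symm]
  · rcases h.crossing_or_count_le a with ⟨S₁, S₂, g, e, k₁, k₂, j, h₁, h₂, rfl, rfl, hg, he⟩ | hle
    · refine ⟨S₁ + S₂, k₁ + k₂, le_rfl, hS, by omega, a, e, k₁ + k₂, ?_, .inl he.symm, ?_⟩
      · simpa [stepCost_of_adj hg.symm] using h₁.join (.inl hg.symm) h₂.symm
      · simp [stepCost_of_adj he.symm]
    · exfalso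
      obtain ⟨T, hT⟩ := Multiset.le_iff_exists_add.1
        ((Multiset.le_iff_subset hS).2 fun t (_ : t ∈ S) => Finset.mem_univ_val t)
      have hdisj : ∀ t ∈ T, t ∉ S := by
        have := (Finset.univ : Finset V).nodup
        rw [hT, Multiset.nodup_add] at this
        exact fun t ht hs => Multiset.disjoint_left.1 this.2.2 hs ht
      have hle2 := countP_add_countP_le (P := G.Adj b) (Q := G.Adj a) T
        fun t ht hh => hout ⟨t, hdisj t ht, hh.2, hh.1⟩
      have hcard : Fintype.card V = Multiset.card S + Multiset.card T := by
        rw [← Multiset.card_add, ← hT]; rfl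
      rw [degree_eq_countP, degree_eq_countP, hT, Multiset.countP_add, Multiset.countP_add] at hab
      simp only [G.irrefl, if_false] at hle
      omega

lemma OCycleCost.exists_zero {S : Multiset V} {k : ℕ} (h : OCycleCost G S k) (hS : S.Nodup) :
    ∃ S', S ≤ S' ∧ S'.Nodup ∧ OCycleCost G S' 0 := by
  induction k using Nat.strong_induction_on generalizing S with
  | _ k ih =>
    rcases Nat.eq_zero_or_pos k with rfl | hk
    · exact ⟨S, le_rfl, hS, h⟩
    obtain ⟨a, b, m, hp, hba, rfl⟩ := h
    have key : ∃ c d m', m' < m + stepCost G b a ∧ OPath G c S d m' ∧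
        Fintype.card V ≤ G.degree c + G.degree d := by
      by_cases hadj : G.Adj b a
      · rw [stepCost_of_adj hadj] at hk ⊢
        obtain ⟨m, rfl⟩ : ∃ m', m = m' + 1 := ⟨m - 1, by omega⟩
        obtain ⟨S₁, S₂, g, e, k₁, k₂, h₁, hge, h₂, rfl, rfl⟩ := hp.exists_nonedge
        refine ⟨e, g, k₂ + 0 + k₁, by omega, ?_, by omega⟩
        have := h₂.join hba h₁
        rwa [stepCost_of_adj hadj, add_comm S₂] at this
      · refine ⟨a, b, m, by simp [stepCost, hadj], hp, ?_⟩
        have := hba.resolve_left hadj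
        omega
    obtain ⟨c, d, m', hm', hp', hcd⟩ := key
    obtain ⟨S', k', hle, hnd, hk', hcyc⟩ := hp'.exists_cycle hS hcd
    obtain ⟨S'', hle', h⟩ := ih k' (by omega) hcyc hnd
    exact ⟨S'', hle.trans hle', h⟩

namespace GPath

lemma join {a b c d : V} {S T : Multiset V} (h₁ : GPath G a S b)
    (hbc : G.Adj b c) (h₂ : GPath G c T d) : GPath G a (S + T) d := by
  simpa [stepCost_of_adj hbc] using OPath.join h₁ (.inl hbc) h₂

lemma cons {a b e : V} {S : Multiset V} (hab : G.Adj a b) (h : GPath G b S e) :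
    GPath G a ({a} + S) e :=
  join (.single a) hab h

lemma hpath {a b : V} {S : Multiset V} (h : GPath G a S b) : HPath G a S b := ⟨0, h⟩

lemma exists_first {P : V → Prop} {a b : V} {S : Multiset V} (h : GPath G a S b)
    (ha : P a) (hS : ∃ t ∈ S, ¬P t) :
    ∃ S₁ S₂ g e, GPath G a S₁ g ∧ G.Adj g e ∧ GPath G e S₂ b ∧ S = S₁ + S₂ ∧
      (∀ t ∈ S₁, P t) ∧ ¬P e := by
  obtain ⟨S₁, S₂, g, e, k₁, k₂, h₁, hge, h₂, hS, hk, hall, he⟩ := OPath.exists_first h ha hS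
  obtain rfl : k₁ = 0 := by omega
  obtain rfl : k₂ = 0 := by omega
  exact ⟨S₁, S₂, g, e, h₁, adj_of_stepCost (by omega), h₂, hS, hall, he⟩

lemma uncons {a b : V} {S : Multiset V} (h : GPath G a S b) :
    (S = {a} ∧ a = b) ∨ ∃ c T, G.Adj a c ∧ GPath G c T b ∧ S = {a} + T := by
  unfold GPath at h
  generalize hk : 0 = k at h
  cases h with
  | single => exact .inl ⟨rfl, rfl⟩
  | @cons _ c _ T m hac h =>
    obtain rfl : m = 0 := by omega
    exact .inr ⟨c, T, adj_of_stepCost (by omega), h, rfl⟩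

lemma unsnoc {a b : V} {S : Multiset V} (h : GPath G a S b) :
    (S = {b} ∧ a = b) ∨ ∃ c T, G.Adj c b ∧ GPath G a T c ∧ S = T + {b} := by
  rcases uncons (OPath.symm h) with ⟨hS, hab⟩ | ⟨c, T, hc, hT, rfl⟩
  · exact .inl ⟨hS, hab.symm⟩
  · exact .inr ⟨c, T, hc.symm, hT.symm, add_comm _ _⟩

lemma split_before {a b w : V} {S : Multiset V} (h : GPath G a S b) (hw : w ∈ S) (ha : w ≠ a) :
    ∃ S₁ S₂ g, GPath G a S₁ g ∧ G.Adj g w ∧ GPath G w S₂ b ∧ S = S₁ + S₂ := by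
  obtain ⟨S₁, S₂, g, e, h₁, hge, h₂, hS, -, he⟩ :=
    h.exists_first (P := fun t => t ≠ w) ha.symm ⟨w, hw, by simp⟩
  obtain rfl : e = w := not_not.1 he
  exact ⟨S₁, S₂, g, h₁, hge, h₂, hS⟩

lemma split_around {a b w : V} {S : Multiset V} (h : GPath G a S b) (hw : w ∈ S) (ha : w ≠ a)
    (hb : w ≠ b) :
    ∃ A B q r, GPath G a A q ∧ G.Adj q w ∧ G.Adj w r ∧ GPath G r B b ∧ S = A + {w} + B := by
  obtain ⟨A, S₂, q, hA, hq, h₂, rfl⟩ := h.split_before hw ha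
  rcases h₂.uncons with ⟨-, rfl⟩ | ⟨r, B, hr, hB, rfl⟩
  · exact absurd rfl hb
  · exact ⟨A, B, q, r, hA, hq, hr, hB, by abel⟩

end GPath

namespace HPath

lemma single (a : V) : HPath G a {a} a := ⟨0, .single a⟩

lemma join {a b c d : V} {S T : Multiset V} (h₁ : HPath G a S b)
    (hbc : OAdj G b c) (h₂ : HPath G c T d) : HPath G a (S + T) d :=
  let ⟨_, h₁⟩ := h₁
  let ⟨_, h₂⟩ := h₂
  ⟨_, h₁.join hbc h₂⟩

lemma symm {a b : V} {S : Multiset V} (h : HPath G a S b) : HPath G b S a :=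
  let ⟨_, h⟩ := h
  ⟨_, h.symm⟩

end HPath

/-- A cycle through all heavy vertices that no closed o-path properly extends. -/
structure IsMaxCycle (G : SimpleGraph V) [DecidableRel G.Adj] (S : Multiset V) : Prop where
  nodup : S.Nodup
  three_le : 3 ≤ Multiset.card S
  cycle : ∃ a b, GPath G a S b ∧ G.Adj b a
  heavy_mem : ∀ v, Heavy G v → v ∈ S
  max : ∀ T a b, T ≠ 0 → (S + T).Nodup → HPath G a (S + T) b → ¬OAdj G b a

/-- A cycle with vertex multiset `S` that runs through `u`, where `p` and `s` are the successor
and the predecessor of `u`. -/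
structure PointedCycle (G : SimpleGraph V) [DecidableRel G.Adj] (S : Multiset V) (u p s : V)
    (T : Multiset V) : Prop where
  up : G.Adj u p
  path : GPath G p T s
  su : G.Adj s u
  eq : S = {u} + T

/-- A cycle with vertex multiset `S` that runs through `u`, then along `A` from `p` to `q`, then
through `v` and along `B` from `r` to `s`. -/
structure SplitCycle (G : SimpleGraph V) [DecidableRel G.Adj] (S : Multiset V) (u p q v r s : V)
    (A B : Multiset V) : Prop where
  up : G.Adj u p
  pathA : GPath G p A q
  qv : G.Adj q v
  vr : G.Adj v r
  pathB : GPath G r B s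
  su : G.Adj s u
  eq : S = {u} + A + {v} + B

/-- A path from `x` to `y` that avoids `S`. -/
structure Outer (G : SimpleGraph V) [DecidableRel G.Adj] (S : Multiset V) (x y : V)
    (E : Multiset V) : Prop where
  path : GPath G x E y
  nodup : E.Nodup
  disj : ∀ t ∈ E, t ∉ S

variable {S T A B E : Multiset V} {u v p q r s x y : V}

namespace PointedCycle

lemma reverse (h : PointedCycle G S u p s T) : PointedCycle G S u s p T :=
  ⟨h.su.symm, h.path.symm, h.up.symm, h.eq⟩

lemma exists_splitCycle (h : PointedCycle G S u p s T) (hv : v ∈ T) (hp : v ≠ p) (hs : v ≠ s) :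
    ∃ A B q r, SplitCycle G S u p q v r s A B := by
  obtain ⟨A, B, q, r, hA, hq, hr, hB, rfl⟩ := h.path.split_around hv hp hs
  exact ⟨A, B, q, r, h.up, hA, hq, hr, hB, h.su, by rw [h.eq]; abel⟩

end PointedCycle

namespace SplitCycle

lemma swap (h : SplitCycle G S u p q v r s A B) : SplitCycle G S v r s u p q B A :=
  ⟨h.vr, h.pathB, h.su, h.up, h.pathA, h.qv, by rw [h.eq]; abel⟩

lemma reverse (h : SplitCycle G S u p q v r s A B) : SplitCycle G S u s r v q p B A :=
  ⟨h.su.symm, h.pathB.symm, h.vr.symm, h.qv.symm, h.pathA.symm, h.up.symm, by rw [h.eq]; abel⟩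

lemma pointed (h : SplitCycle G S u p q v r s A B) : PointedCycle G S u p s (A + {v} + B) :=
  ⟨h.up, (h.pathA.join h.qv (.single v)).join h.vr h.pathB, h.su, by rw [h.eq]; abel⟩

lemma ne (h : SplitCycle G S u p q v r s A B) (hS : S.Nodup) : s ≠ p := by
  rintro rfl
  rw [h.eq, Multiset.nodup_add] at hS
  exact Multiset.disjoint_left.1 hS.2.2 (by simp [h.pathA.start_mem]) h.pathB.end_mem

end SplitCycle

namespace Outer

lemma reverse (h : Outer G S x y E) : Outer G S y x E :=
  ⟨h.path.symm, h.nodup, h.disj⟩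

lemma singleton (hx : x ∉ S) : Outer G S x x {x} :=
  ⟨.single x, by simp, by simpa using hx⟩

lemma pair (hx : x ∉ S) (hy : y ∉ S) (h : G.Adj x y) : Outer G S x y ({x} + {y}) :=
  ⟨.cons h (.single y), by simp [h.ne], by
    intro t ht
    rcases Multiset.mem_add.1 ht with ht | ht <;> rw [Multiset.mem_singleton.1 ht] <;> assumption⟩

end Outer

namespace IsMaxCycle

variable (hC : IsMaxCycle G S)
include hC

lemma false_of_cycle {U : Multiset V} {a b : V} (hE : Outer G S x y E) (h : HPath G a U b)
    (hba : OAdj G b a) (hU : U = S + E) : False := by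
  subst hU
  refine hC.max E a b ?_ ?_ h hba
  · rintro rfl
    exact absurd hE.path.start_mem (by simp)
  · rw [Multiset.nodup_add]
    exact ⟨hC.nodup, hE.nodup, Multiset.disjoint_right.2 fun {t} ht => hE.disj t ht⟩

lemma not_oadj_succ (hE : Outer G S x y E) (hc : PointedCycle G S u p s T) (hx : G.Adj x u) :
    ¬OAdj G y p := fun hy =>
  hC.false_of_cycle hE
    ((hE.path.hpath.join hy hc.path.hpath).join (.inl hc.su) (.single u)) (.inl hx.symm)
    (by rw [hc.eq]; abel)

lemma not_oadj_succ_succ (hE : Outer G S x y E) (hc : SplitCycle G S u p q v r s A B)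
    (hx : G.Adj x u) (hy : G.Adj y v) : ¬OAdj G p r := fun h =>
  hC.false_of_cycle hE
    ((((hE.path.hpath.join (.inl hy) (.single v)).join (.inl hc.qv.symm)
      hc.pathA.hpath.symm).join h hc.pathB.hpath).join (.inl hc.su) (.single u)) (.inl hx.symm)
    (by rw [hc.eq]; abel)

lemma not_oadj_pred_pred (hE : Outer G S x y E) (hc : SplitCycle G S u p q v r s A B)
    (hx : G.Adj x u) (hy : G.Adj y v) : ¬OAdj G s q :=
  hC.not_oadj_succ_succ hE hc.reverse hx hy

lemma oadj_around (ho : OHeavy G) (hx : x ∉ S) (hxu : G.Adj x u)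
    (hc : SplitCycle G S u p q v r s A B) : OAdj G s p := by
  by_contra hsp
  have hxp : ¬OAdj G x p := hC.not_oadj_succ (.singleton hx) hc.pointed hxu
  have hxs : ¬OAdj G x s := hC.not_oadj_succ (.singleton hx) hc.pointed.reverse hxu
  have hpS : p ∈ S := by rw [hc.eq]; simp [hc.pathA.start_mem]
  have hsS : s ∈ S := by rw [hc.eq]; simp [hc.pathB.end_mem]
  have key := ho u s p x ⟨hc.ne hC.nodup, fun h => hx (h ▸ hsS), fun h => hx (h ▸ hpS), hc.su.symm,
    hc.up, hxu.symm, fun h => hsp (.inl h), fun h => hxs (.inl h.symm),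
    fun h => hxp (.inl h.symm)⟩
  rcases key with h | h | h
  · exact hsp (.inr h)
  · exact hxs (OAdj.symm (.inr h))
  · exact hxp (OAdj.symm (.inr h))

lemma not_oadj_cross (hE : Outer G S x y E) (hc : SplitCycle G S u p q v r s A B)
    (hx : G.Adj x u) (hy : G.Adj y v) (hsp : OAdj G s p) : ¬OAdj G u r := fun h =>
  hC.false_of_cycle hE
    (((((HPath.single u).join (.inl hx.symm) hE.path.hpath).join (.inl hy) (.single v)).join
      (.inl hc.qv.symm) hc.pathA.hpath.symm).join hsp.symm hc.pathB.hpath.symm)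
    h.symm (by rw [hc.eq]; abel)

/-- A chord from `u` to a vertex `g` of the cycle makes the successor `e` of `g` unreachable by
outer paths starting at `u`. -/
lemma not_adj_of_chord {T₁ T₂ : Multiset V} {g e : V} (hE : Outer G S x y E)
    (hx : G.Adj x u) (h₁ : GPath G p T₁ g) (h₂ : GPath G e T₂ s)
    (hS : S = {u} + (T₁ + T₂)) (hsp : OAdj G s p) (hug : G.Adj u g) : ¬G.Adj y e := fun h =>
  hC.false_of_cycle hE
    ((((HPath.single u).join (.inl hx.symm) hE.path.hpath).join (.inl h) h₂.hpath).join hsp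
      h₁.hpath) (.inl hug.symm) (by rw [hS]; abel)

lemma not_adj_of_chord_of_splitCycle {A₁ A₂ : Multiset V} {g e : V} (hE : Outer G S x y E)
    (hc : SplitCycle G S u p q v r s A B) (hx : G.Adj x u) (hy : G.Adj y v) (hsp : OAdj G s p)
    (hqr : OAdj G q r) (h₁ : GPath G p A₁ g) (h₂ : GPath G e A₂ q)
    (hA : A = A₁ + A₂) (hug : G.Adj u g) : ¬G.Adj v e := fun h =>
  hC.false_of_cycle hE
    ((((((HPath.single u).join (.inl hx.symm) hE.path.hpath).join (.inl hy) (.single v)).join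
      (.inl h) h₂.hpath).join hqr hc.pathB.hpath).join hsp h₁.hpath) (.inl hug.symm)
    (by rw [hc.eq, hA]; abel)

lemma exists_splitCycle_of_adj (hE : Outer G S x y E) (hc : PointedCycle G S u p s T) (hx : G.Adj x u)
    (hv : v ∈ S) (hvu : v ≠ u) (hy : G.Adj y v) : ∃ A B q r, SplitCycle G S u p q v r s A B := by
  refine hc.exists_splitCycle ?_ ?_ ?_
  · rw [hc.eq] at hv
    simpa [hvu] using hv
  · rintro rfl
    exact hC.not_oadj_succ hE hc hx (.inl hy)
  · rintro rfl
    exact hC.not_oadj_succ hE hc.reverse hx (.inl hy)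

variable (ho : OHeavy G)
include ho

lemma eq_of_common_neighbor (hx : x ∉ S) (hc : PointedCycle G S u p s T) (hxu : G.Adj x u)
    {w : V} (hwp : G.Adj p w) (hwx : G.Adj x w) : w = u := by
  by_contra hwu
  by_cases hw : w ∈ S
  · obtain ⟨A, B, q, r, hr⟩ := hC.exists_splitCycle_of_adj (.singleton hx) hc hxu hw hwu hwx
    exact hC.not_oadj_cross (.singleton hx) hr.swap hwx hxu
      (hC.oadj_around ho hx hwx hr.swap) (.inl hwp.symm)
  · exact hC.not_oadj_succ (.pair hx hw hwx) hc hxu (.inl hwp.symm)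

variable [DecidableEq V]

omit ho in
lemma heavy_of_fanOrShi {a : V} (hx : x ∉ S) (h : FanOrShi G a x)
    (ha : ∀ w, G.Adj a w → G.Adj x w → w = u) : Heavy G a := by
  rcases h with h | h | h
  · exact h
  · exact absurd (hC.heavy_mem x h) hx
  · have : (G.neighborFinset a ∩ G.neighborFinset x).card ≤ ({u} : Finset V).card :=
      Finset.card_le_card fun w hw => by
        simp only [Finset.mem_inter, mem_neighborFinset] at hw
        simpa using ha w hw.1 hw.2
    rw [Finset.card_singleton] at this
    omega

variable (hZ : ∀ a1 a2 a3 b1 c1 : V, IsInducedZ2 G a1 a2 a3 b1 c1 →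
      FanOrShi G a2 b1 ∧ FanOrShi G a3 b1 ∧ FanOrShi G a1 c1)
include hZ

lemma le_degree_add {c : V} (hx : x ∉ S) (hc : SplitCycle G S u p q v r s A B) (hxu : G.Adj x u)
    (hxc : G.Adj x c) (hcu : c ≠ u) (hcu' : ¬G.Adj c u) (hcp : ¬G.Adj c p) (hcs : ¬G.Adj c s) :
    Fintype.card V ≤ G.degree s + G.degree p := by
  rcases hC.oadj_around ho hx hxu hc with hsp | hsp
  · have hxp : ¬OAdj G x p := hC.not_oadj_succ (.singleton hx) hc.pointed hxu
    have hxs : ¬OAdj G x s := hC.not_oadj_succ (.singleton hx) hc.pointed.reverse hxu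
    have hpS : p ∈ S := by rw [hc.eq]; simp [hc.pathA.start_mem]
    have hsS : s ∈ S := by rw [hc.eq]; simp [hc.pathB.end_mem]
    obtain ⟨h1, h2, -⟩ := hZ u s p x c ⟨hc.su.symm, hc.up, hsp, hxu.symm, hxc,
      fun h => hx (h ▸ hsS), fun h => hx (h ▸ hpS), hcu, fun h => hcu' (h ▸ hc.su),
      fun h => hcu' (h ▸ hc.up.symm), fun h => hxs (.inl h), fun h => hxp (.inl h), hcu', hcs, hcp⟩
    have hs := hC.heavy_of_fanOrShi hx h1
      fun w hw hxw => hC.eq_of_common_neighbor ho hx hc.pointed.reverse hxu hw hxw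
    have hp := hC.heavy_of_fanOrShi hx h2
      fun w hw hxw => hC.eq_of_common_neighbor ho hx hc.pointed hxu hw hxw
    unfold Heavy at hs hp
    omega
  · exact hsp

omit ho hZ [DecidableEq V] in
lemma exists_pointed (hu : u ∈ S) : ∃ p s T, PointedCycle G S u p s T := by
  obtain ⟨a, b, hp, hba⟩ := hC.cycle
  have h3 := hC.three_le
  by_cases hua : u = a
  · subst hua
    rcases hp.uncons with ⟨rfl, -⟩ | ⟨c, T, hc, hT, hS⟩
    · simp at h3
    · exact ⟨c, b, T, hc, hT, hba, hS⟩
  · obtain ⟨S₁, S₂, g, h₁, hg, h₂, rfl⟩ := hp.split_before hu hua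
    rcases h₂.uncons with ⟨rfl, rfl⟩ | ⟨c, T, hc, hT, rfl⟩
    · exact ⟨a, g, S₁, hba, h₁, hg, add_comm _ _⟩
    · exact ⟨c, g, T + S₁, hc, hT.join hba h₁, hg, by abel⟩

omit ho hZ [DecidableEq V] in
lemma exists_splitCycle (hE : Outer G S x y E) (hu : u ∈ S) (hv : v ∈ S) (huv : u ≠ v)
    (hx : G.Adj x u) (hy : G.Adj y v) : ∃ A B p q r s, SplitCycle G S u p q v r s A B := by
  obtain ⟨p, s, T, hc⟩ := hC.exists_pointed hu
  obtain ⟨A, B, q, r, h⟩ := hC.exists_splitCycle_of_adj hE hc hx hv huv.symm hy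
  exact ⟨A, B, p, q, r, s, h⟩

omit ho hZ [DecidableEq V] in
lemma not_degree_sums (hE : Outer G S x y E) (hc : SplitCycle G S u p q v r s A B)
    (hx : G.Adj x u) (hy : G.Adj y v) (h : Fintype.card V ≤ G.degree s + G.degree p) :
    ¬Fintype.card V ≤ G.degree q + G.degree r := by
  intro h'
  have h1 := hC.not_oadj_succ_succ hE hc hx hy
  have h2 := hC.not_oadj_pred_pred hE hc hx hy
  unfold OAdj at h1 h2
  omega

lemma adj_of_common_outer_neighbor (hx : x ∉ S) (hu : u ∈ S) (hv : v ∈ S) (huv : u ≠ v)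
    (hxu : G.Adj x u) (hxv : G.Adj x v) : G.Adj u v := by
  by_contra hn
  obtain ⟨A, B, p, q, r, s, hc⟩ := hC.exists_splitCycle (.singleton hx) hu hv huv hxu hxv
  have key {u v p q r s : V} {A B : Multiset V} (hc : SplitCycle G S u p q v r s A B)
      (hxu : G.Adj x u) (hxv : G.Adj x v) (huv : u ≠ v) (hn : ¬G.Adj u v) :=
    hC.le_degree_add ho hZ hx hc hxu hxv huv.symm (fun h => hn h.symm)
      (fun h => huv.symm (hC.eq_of_common_neighbor ho hx hc.pointed hxu h.symm hxv))
      (fun h => huv.symm (hC.eq_of_common_neighbor ho hx hc.pointed.reverse hxu h.symm hxv))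
  exact hC.not_degree_sums (.singleton hx) hc hxu hxv (key hc hxu hxv huv hn)
    (key hc.swap hxv hxu huv.symm fun h => hn h.symm)

variable {T₁ T₂ : Multiset V} {z w : V}

lemma not_adj_run (hx : x ∉ S) (hc : PointedCycle G S u p s (T₁ + T₂)) (h₁ : GPath G p T₁ z)
    (hzy : G.Adj z y) (h₂ : GPath G y T₂ s) (hrun : ∀ t ∈ T₁, G.Adj u t) (hy : ¬G.Adj u y)
    (hxu : G.Adj x u) (hw : w ∈ S) (hwu : w ≠ u) (hxw : G.Adj x w) :
    ¬G.Adj w z ∧ ¬G.Adj w y := by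
  have hxp : ¬OAdj G x p := hC.not_oadj_succ (.singleton hx) hc hxu
  have hxs : ¬OAdj G x s := hC.not_oadj_succ (.singleton hx) hc.reverse hxu
  have hsp : OAdj G s p := by
    obtain ⟨A, B, q, r, h⟩ := hC.exists_splitCycle_of_adj (.singleton hx) hc hxu hw hwu hxw
    exact hC.oadj_around ho hx hxu h
  have huS : u ∈ S := by rw [hc.eq]; simp
  have hwy : w ≠ y := by
    rintro rfl
    exact hy (hC.adj_of_common_outer_neighbor ho hZ hx huS hw hwu.symm hxu hxw)
  have hw' : w ∈ T₁ ∨ w ∈ T₂ := by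
    rw [hc.eq] at hw
    simpa [hwu] using hw
  rcases hw' with hw' | hw'
  · exfalso
    obtain ⟨L, L', g, hL, -, hL', rfl⟩ :=
      h₁.split_before hw' (by rintro rfl; exact hxp (.inl hxw))
    exact hC.not_adj_of_chord (.singleton hx) hxu hL (hL'.join hzy h₂) (by rw [hc.eq]; abel) hsp
      (hrun g (by simp [hL.end_mem])) hxw
  · obtain ⟨C, D, q, r, hC', hq, hr, hD, rfl⟩ :=
      h₂.split_around hw' hwy (by rintro rfl; exact hxs (.inl hxw))
    have hring : SplitCycle G S u p q w r s (T₁ + C) D :=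
      ⟨hc.up, h₁.join hzy hC', hq, hr, hD, hc.su, by rw [hc.eq]; abel⟩
    have hqr : OAdj G q r := hC.oadj_around ho hx hxw hring.swap
    refine ⟨?_, hC.not_adj_of_chord_of_splitCycle (.singleton hx) hring hxu hxw hsp hqr h₁ hC' rfl
      (hrun z h₁.end_mem)⟩
    rcases h₁.unsnoc with ⟨-, rfl⟩ | ⟨z', T', hz', hT', rfl⟩
    · exact fun h => hwu (hC.eq_of_common_neighbor ho hx hc hxu h.symm hxw)
    · exact hC.not_adj_of_chord_of_splitCycle (.singleton hx) hring hxu hxw hsp hqr hT' (hC'.cons hzy)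
        (by abel) (hrun z' (by simp [hT'.end_mem]))

/-- The last vertex of the initial run of neighbours of `u` is heavy. -/
lemma heavy_of_run (hx : x ∉ S) (hc : PointedCycle G S u p s (T₁ + T₂)) (h₁ : GPath G p T₁ z)
    (hzy : G.Adj z y) (h₂ : GPath G y T₂ s) (hrun : ∀ t ∈ T₁, G.Adj u t) (hy : ¬G.Adj u y)
    (hxu : G.Adj x u) (hv : v ∈ S) (hvu : v ≠ u) (hxv : G.Adj x v) : Heavy G z := by
  have huS : u ∈ S := by rw [hc.eq]; simp
  have hzS : z ∈ S := by rw [hc.eq]; simp [h₁.end_mem]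
  have hyS : y ∈ S := by rw [hc.eq]; simp [h₂.start_mem]
  have hyu : y ≠ u := by
    rintro rfl
    have := hC.nodup
    rw [hc.eq, Multiset.singleton_add, Multiset.nodup_cons] at this
    exact this.1 (by simp [h₂.start_mem])
  have hsp : OAdj G s p := by
    obtain ⟨A, B, q, r, h⟩ := hC.exists_splitCycle_of_adj (.singleton hx) hc hxu hv hvu hxv
    exact hC.oadj_around ho hx hxu h
  have hout {y' : V} {E : Multiset V} (hE : Outer G S x y' E) : ¬G.Adj y' z := by
    rcases h₁.unsnoc with ⟨-, rfl⟩ | ⟨z', T', hz', hT', rfl⟩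
    · exact fun h => hC.not_oadj_succ hE hc hxu (.inl h)
    · exact hC.not_adj_of_chord hE hxu hT' (h₂.cons hzy) (by rw [hc.eq]; abel) hsp
        (hrun z' (by simp [hT'.end_mem]))
  have hxz : ¬G.Adj x z := hout (.singleton hx)
  have hxy : ¬G.Adj x y := fun h =>
    hy (hC.adj_of_common_outer_neighbor ho hZ hx huS hyS hyu.symm hxu h)
  obtain ⟨hvz, hvy⟩ := hC.not_adj_run ho hZ hx hc h₁ hzy h₂ hrun hy hxu hv hvu hxv
  obtain ⟨h, -, -⟩ := hZ u x v z y ⟨hxu.symm,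
    hC.adj_of_common_outer_neighbor ho hZ hx huS hv hvu.symm hxu hxv, hxv,
    hrun z h₁.end_mem, hzy, fun h => hx (h ▸ hzS), fun h => hxz (h ▸ hxv), hyu,
    fun h => hx (h ▸ hyS), fun h => hxy (h ▸ hxv), fun h => hxz h.symm, fun h => hvz h.symm,
    fun h => hy h.symm, fun h => hxy h.symm, fun h => hvy h.symm⟩
  refine hC.heavy_of_fanOrShi (u := u) hx (a := z) ?_ ?_
  · rcases h with h | h | h
    · exact .inr (.inl h)
    · exact .inl h
    · exact .inr (.inr (by rwa [Finset.inter_comm]))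
  · intro w hzw hxw
    by_contra hwu
    by_cases hw : w ∈ S
    · exact (hC.not_adj_run ho hZ hx hc h₁ hzy h₂ hrun hy hxu hw hwu hxw).1 hzw.symm
    · exact hout (.pair hx hw hxw) hzw.symm

omit ho hZ hC [DecidableEq V] in
lemma exists_detour (h₁ : GPath G p T₁ z) (hrun : ∀ t ∈ T₁, G.Adj u t) (hsp : OAdj G s p)
    (hsu : G.Adj s u) :
    ∃ T e, T₁ = {z} + T ∧ HPath G u ({u} + T) e ∧ OAdj G e s := by
  rcases h₁.unsnoc with ⟨rfl, rfl⟩ | ⟨z', T', hz', hT', rfl⟩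
  · exact ⟨0, u, rfl, by simpa using HPath.single u, .inl hsu.symm⟩
  · exact ⟨T', p, add_comm _ _, (HPath.single u).join
      (.inl (hrun z' (by simp [hT'.end_mem]))) hT'.hpath.symm, hsp.symm⟩

/-- An outer vertex has at most one neighbour on the cycle. -/
lemma eq_of_outer_adj (hx : x ∉ S) (hu : u ∈ S) (hv : v ∈ S) (hxu : G.Adj x u)
    (hxv : G.Adj x v) : u = v := by
  by_contra huv
  have run {u v p q r s : V} {A B : Multiset V} (hc : SplitCycle G S u p q v r s A B)
      (hxu : G.Adj x u) (hxv : G.Adj x v) (hv : v ∈ S) (huv : u ≠ v) :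
      ∃ A' A₂ z y e, A = {z} + A' + A₂ ∧ G.Adj z y ∧ GPath G y A₂ q ∧ Heavy G z ∧
        HPath G u ({u} + A') e ∧ OAdj G e s := by
    have hsp := hC.oadj_around ho hx hxu hc
    have huq : ¬G.Adj u q := fun h =>
      hC.not_oadj_cross (.singleton hx) hc.reverse hxu hxv hsp.symm (.inl h)
    obtain ⟨A₁, A₂, z, y, h₁, hzy, h₂, rfl, hrun, hy⟩ :=
      hc.pathA.exists_first (P := G.Adj u) hc.up ⟨q, hc.pathA.end_mem, huq⟩
    have hz : Heavy G z := hC.heavy_of_run ho hZ hx (T₂ := A₂ + {v} + B)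
      ⟨hc.up, h₁.join hzy ((h₂.join hc.qv (.single v)).join hc.vr hc.pathB), hc.su, by
        rw [hc.eq]; abel⟩ h₁ hzy ((h₂.join hc.qv (.single v)).join hc.vr hc.pathB) hrun hy hxu hv
      (Ne.symm huv) hxv
    obtain ⟨A', e, rfl, hp, he⟩ := exists_detour h₁ hrun hsp hc.su
    exact ⟨A', A₂, z, y, e, rfl, hzy, h₂, hz, hp, he⟩
  obtain ⟨A, B, p, q, r, s, hc⟩ := hC.exists_splitCycle (.singleton hx) hu hv huv hxu hxv
  obtain ⟨A', A₂, z, y, e, hA, hzy, hA₂, hz, hu', he⟩ := run hc hxu hxv hv huv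
  obtain ⟨B', B₂, z', y', e', hB, hzy', hB₂, hz', hv', he'⟩ :=
    run hc.swap hxv hxu hu (Ne.symm huv)
  have hzz' : OAdj G z' z := by
    unfold Heavy at hz hz'
    exact .inr (by omega)
  exact hC.false_of_cycle (.singleton hx)
    (((((((HPath.single x).join (.inl hxu) hu').join he hB₂.hpath.symm).join (.inl hzy'.symm)
      (.single z')).join hzz' (.single z)).join (.inl hzy) hA₂.hpath).join he'.symm hv'.symm)
    (.inl hxv.symm) (by rw [hc.eq, hA, hB]; abel)

/-- There is no path outside the cycle between two distinct vertices of it. -/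
lemma not_outer (hE : Outer G S x y E) (hu : u ∈ S) (hv : v ∈ S) (huv : u ≠ v)
    (hxu : G.Adj x u) (hyv : G.Adj y v) : False := by
  induction hn : Multiset.card E using Nat.strong_induction_on generalizing E x y with
  | _ n ih =>
    obtain ⟨A, B, p, q, r, s, hc⟩ := hC.exists_splitCycle hE hu hv huv hxu hyv
    have key {u v p q r s x y : V} {A B E : Multiset V} (hc : SplitCycle G S u p q v r s A B)
        (hE : Outer G S x y E) (hu : u ∈ S) (hv : v ∈ S) (huv : u ≠ v) (hxu : G.Adj x u)
        (hyv : G.Adj y v) (ih : ∀ {x' E'}, Multiset.card E' < Multiset.card E →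
          Outer G S x' y E' → ¬G.Adj x' u) :
        Fintype.card V ≤ G.degree s + G.degree p := by
      have hx : x ∉ S := hE.disj x hE.path.start_mem
      rcases hE.path.uncons with ⟨-, rfl⟩ | ⟨c, E', hxc, hE', rfl⟩
      · exact absurd (hC.eq_of_outer_adj ho hZ hx hu hv hxu hyv) huv
      have hcS : c ∉ S := hE.disj c (by simp [hE'.start_mem])
      refine hC.le_degree_add ho hZ hx hc hxu hxc (fun h => hcS (h ▸ hu)) ?_
        (fun h => hC.not_oadj_succ (.pair hx hcS hxc) hc.pointed hxu (.inl h))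
        (fun h => hC.not_oadj_succ (.pair hx hcS hxc) hc.pointed.reverse hxu (.inl h))
      refine ih (E' := E') (by simp) ⟨hE', ?_, fun t ht => hE.disj t (by simp [ht])⟩
      exact (Multiset.nodup_add.1 hE.nodup).2.1
    refine hC.not_degree_sums hE hc hxu hyv (key hc hE hu hv huv hxu hyv ?_)
      (key hc.swap hE.reverse hv hu huv.symm hyv hxu ?_)
    · exact fun hlt hE' h => ih _ (hn ▸ hlt) hE' h hyv rfl
    · exact fun hlt hE' h => ih _ (hn ▸ hlt) hE'.reverse hxu h rfl

end IsMaxCycle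

lemma exists_gpath_of_walk {a b : V} (w : G.Walk a b) : GPath G a (w.support : Multiset V) b := by
  induction w with
  | nil => exact .single _
  | cons hab w ih => exact ih.cons hab

lemma GPath.exists_walk {a b : V} {S : Multiset V} (h : GPath G a S b) :
    ∃ w : G.Walk a b, (w.support : Multiset V) = S := by
  unfold GPath at h
  generalize hk : 0 = k at h
  induction h with
  | single a => exact ⟨.nil, rfl⟩
  | cons hab h ih =>
    obtain ⟨w, rfl⟩ := ih (by omega)
    exact ⟨.cons (adj_of_stepCost (by omega)) w, rfl⟩

lemma exists_gpath_avoiding {a b v : V} (h : (G.induce {w | w ≠ v}).Connected) (ha : a ≠ v)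
    (hb : b ≠ v) : ∃ T, GPath G a T b ∧ T.Nodup ∧ v ∉ T := by
  classical
  obtain ⟨w⟩ := h.preconnected ⟨a, ha⟩ ⟨b, hb⟩
  refine ⟨_, exists_gpath_of_walk (w.bypass.map (Embedding.induce {w | w ≠ v}).toHom), ?_, ?_⟩
  · rw [Multiset.coe_nodup, Walk.support_map]
    exact w.bypass_isPath.support_nodup.map Subtype.val_injective
  · rw [Multiset.mem_coe, Walk.support_map, List.mem_map]
    rintro ⟨t, -, ht⟩
    exact t.2 ht

lemma exists_adj_ne (h2 : TwoConnected G) {a v : V} (hav : a ≠ v) : ∃ c, G.Adj a c ∧ c ≠ v := by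
  classical
  obtain ⟨w, hw⟩ : ∃ w, w ∉ ({a, v} : Finset V) := by
    by_contra! hall
    have := Finset.card_le_card (fun w _ => hall w : (Finset.univ : Finset V) ⊆ {a, v})
    have := Finset.card_le_two (a := a) (b := v)
    have := h2.1
    rw [Finset.card_univ] at *
    omega
  simp only [Finset.mem_insert, Finset.mem_singleton, not_or] at hw
  obtain ⟨T, hT, -, hvT⟩ := exists_gpath_avoiding (h2.2 v) hav hw.2
  rcases hT.uncons with ⟨-, rfl⟩ | ⟨c, T', hc, hT', rfl⟩
  · exact absurd rfl hw.1
  · exact ⟨c, hc, fun h => hvT (by simp [← h, hT'.start_mem])⟩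

/-- A set of vertices that is not everything is connected to itself by a path outside it. -/
lemma exists_outer (h2 : TwoConnected G) {S : Multiset V} {x : V} (hx : x ∉ S) (hS : S.Nodup)
    (h3 : 3 ≤ Multiset.card S) :
    ∃ E y z u v, Outer G S y z E ∧ u ∈ S ∧ v ∈ S ∧ u ≠ v ∧ G.Adj y u ∧ G.Adj z v := by
  have other (u : V) : ∃ s ∈ S, s ≠ u := by
    by_contra! hall
    have hle : S ≤ {u} := (Multiset.le_iff_subset hS).2 fun t ht => by simp [hall t ht]
    have := Multiset.card_le_card hle
    simp only [Multiset.card_singleton] at this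
    omega
  have reach {x u : V} (hx : x ∉ S) (hxu : x ≠ u) :
      ∃ E z v, GPath G x E z ∧ E.Nodup ∧ (∀ t ∈ E, t ∉ S) ∧ G.Adj z v ∧ v ∈ S ∧ v ≠ u := by
    obtain ⟨s, hs, hsu⟩ := other u
    obtain ⟨T, hT, hnd, huT⟩ := exists_gpath_avoiding (h2.2 u) hxu hsu
    obtain ⟨S₁, S₂, g, e, h₁, hge, h₂, rfl, hall, he⟩ :=
      hT.exists_first (P := fun t => t ∉ S) hx ⟨s, hT.end_mem, by simpa using hs⟩
    exact ⟨S₁, g, e, h₁, (Multiset.nodup_add.1 hnd).1, hall, hge, not_not.1 he,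
      fun h => huT (by simp [← h, h₂.start_mem])⟩
  obtain ⟨c, hc, -⟩ := other x
  obtain ⟨E, y, u, hE, -, hES, hyu, hu, -⟩ := reach hx (u := c) (by rintro rfl; exact hx hc)
  have hy : y ∉ S := hES y hE.end_mem
  obtain ⟨E, z, v, hE, hnd, hES, hzv, hv, hvu⟩ := reach hy (u := u) (by rintro rfl; exact hy hu)
  exact ⟨E, y, z, u, v, ⟨hE, hnd, hES⟩, hu, hv, hvu.symm, hyu, hzv⟩

lemma exists_hpath_of_pairwise {S : Multiset V} (h0 : S ≠ 0)
    (h : ∀ a ∈ S, ∀ b ∈ S, OAdj G a b) : ∃ a b, HPath G a S b ∧ a ∈ S ∧ b ∈ S := by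
  induction S using Multiset.induction with
  | empty => exact absurd rfl h0
  | cons a S ih =>
    by_cases hS : S = 0
    · subst hS
      exact ⟨a, a, .single a, by simp, by simp⟩
    · obtain ⟨b, c, hp, hb, hc⟩ := ih hS fun a ha b hb =>
        h a (Multiset.mem_cons_of_mem ha) b (Multiset.mem_cons_of_mem hb)
      exact ⟨a, c, (HPath.single a).join (h a (by simp) b (by simp [hb])) hp, by simp,
        by simp [hc]⟩

lemma exists_ocycle_of_oadj (h2 : TwoConnected G) {a b : V} (hne : a ≠ b) (hab : OAdj G a b) :
    ∃ S k, S.Nodup ∧ 3 ≤ Multiset.card S ∧ a ∈ S ∧ b ∈ S ∧ OCycleCost G S k := by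
  obtain ⟨c, hac, hcb⟩ := exists_adj_ne h2 hne
  obtain ⟨T, hT, hnd, haT⟩ := exists_gpath_avoiding (h2.2 a) hac.ne.symm hne.symm
  refine ⟨{a} + T, _, Multiset.nodup_cons.2 ⟨haT, hnd⟩, ?_, by simp, by simp [hT.end_mem], a, b,
    0, hT.cons hac, hab.symm, rfl⟩
  rcases hT.uncons with ⟨-, rfl⟩ | ⟨d, T', -, hT', rfl⟩
  · exact absurd rfl hcb
  · have := Multiset.card_pos_iff_exists_mem.2 ⟨d, hT'.start_mem⟩
    simp only [Multiset.card_add, Multiset.card_singleton]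
    omega

lemma exists_heavy_ocycle (h2 : TwoConnected G) :
    ∃ S k, S.Nodup ∧ 3 ≤ Multiset.card S ∧ (∀ v, Heavy G v → v ∈ S) ∧ OCycleCost G S k := by
  classical
  have hH : ∀ v, Heavy G v ↔ v ∈ (Finset.univ.filter (Heavy G)).val := by simp
  have hnd := (Finset.univ.filter (Heavy G)).nodup
  generalize (Finset.univ.filter (Heavy G)).val = H at hH hnd
  have hadj : ∀ a ∈ H, ∀ b ∈ H, OAdj G a b := fun a ha b hb => by
    have ha' := (hH a).2 ha
    have hb' := (hH b).2 hb
    unfold Heavy at ha' hb'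
    exact .inr (by omega)
  by_cases h3 : 3 ≤ Multiset.card H
  · obtain ⟨a, b, ⟨k, hp⟩, ha, hb⟩ :=
      exists_hpath_of_pairwise (by rintro rfl; simp at h3) hadj
    exact ⟨H, _, hnd, h3, fun v hv => (hH v).1 hv, a, b, k, hp, hadj b hb a ha, rfl⟩
  · have key : ∃ a b, a ≠ b ∧ OAdj G a b ∧ ∀ v ∈ H, v = a ∨ v = b := by
      by_cases hc2 : Multiset.card H = 2
      · obtain ⟨a, b, rfl⟩ := Multiset.card_eq_two.1 hc2
        exact ⟨a, b, by simpa using hnd, hadj a (by simp) b (by simp), by simp⟩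
      · obtain ⟨a, ha⟩ : ∃ a, ∀ v ∈ H, v = a := by
          rcases Nat.lt_or_ge 0 (Multiset.card H) with h | h
          · obtain ⟨a, rfl⟩ := Multiset.card_eq_one.1 (by omega : Multiset.card H = 1)
            exact ⟨a, by simp⟩
          · obtain rfl := Multiset.card_eq_zero.1 (Nat.le_zero.1 h)
            have : Nonempty V := Fintype.card_pos_iff.1 (by have := h2.1; omega)
            exact ⟨Classical.arbitrary V, by simp⟩
        have : Nontrivial V := Fintype.one_lt_card_iff_nontrivial.1 (by have := h2.1; omega)
        obtain ⟨v, hv⟩ := exists_ne a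
        obtain ⟨b, hb, -⟩ := exists_adj_ne h2 hv.symm
        exact ⟨a, b, hb.ne, .inl hb, fun v hv => .inl (ha v hv)⟩
    obtain ⟨a, b, hne, hab, hcov⟩ := key
    obtain ⟨S, k, hS, h3, ha, hb, hc⟩ := exists_ocycle_of_oadj h2 hne hab
    refine ⟨S, k, hS, h3, fun v hv => ?_, hc⟩
    rcases hcov v ((hH v).1 hv) with rfl | rfl <;> assumption

lemma exists_isMaxCycle (h2 : TwoConnected G) : ∃ S, IsMaxCycle G S := by
  obtain ⟨S₀, k, hnd₀, h3₀, hh₀, hc₀⟩ := exists_heavy_ocycle h2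
  obtain ⟨S₁, hle, hnd₁, hc₁⟩ := hc₀.exists_zero hnd₀
  obtain ⟨S, ⟨hnd, h3, hh, hc⟩, hmin⟩ :=
    (measure fun S : Multiset V => Fintype.card V - Multiset.card S).wf.has_min
      {S | S.Nodup ∧ 3 ≤ Multiset.card S ∧ (∀ v, Heavy G v → v ∈ S) ∧ OCycleCost G S 0}
      ⟨S₁, hnd₁, h3₀.trans (Multiset.card_le_card hle),
        fun v hv => Multiset.mem_of_le hle (hh₀ v hv), hc₁⟩
  refine ⟨S, hnd, h3, ?_, hh, ?_⟩
  · obtain ⟨a, b, m, hp, -, hm⟩ := hc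
    obtain rfl : m = 0 := by omega
    exact ⟨a, b, hp, adj_of_stepCost (by omega)⟩
  · rintro T a b hT0 hndT ⟨m, hp⟩ hba
    obtain ⟨S', hle', hnd', hc'⟩ :=
      OCycleCost.exists_zero ⟨a, b, m, hp, hba, rfl⟩ hndT
    have hSS' : S ≤ S' := (Multiset.le_add_right S T).trans hle'
    refine hmin S' ⟨hnd', h3.trans (Multiset.card_le_card hSS'),
      fun v hv => Multiset.mem_of_le hSS' (hh v hv), hc'⟩ ?_
    have h1 := Multiset.card_le_card hle'
    have h2 : Multiset.card S' ≤ Fintype.card V := Multiset.card_le_card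
      ((Multiset.le_iff_subset hnd').2 fun t _ => Finset.mem_univ_val t)
    have h3 := Multiset.card_pos.2 hT0
    rw [Multiset.card_add] at h1
    change Fintype.card V - Multiset.card S' < Fintype.card V - Multiset.card S
    omega

lemma IsMaxCycle.isHamiltonian [DecidableEq V] {S : Multiset V} (hC : IsMaxCycle G S)
    (hall : ∀ x, x ∈ S) : G.IsHamiltonian := by
  obtain ⟨a, b, hp, hba⟩ := hC.cycle
  obtain ⟨w, rfl⟩ := hp.exists_walk
  have hw : w.IsPath := Walk.isPath_def w |>.2 hC.nodup
  intro _
  refine ⟨b, .cons hba w, Walk.isHamiltonianCycle_iff_isCycle_and_support_count_tail_eq_one.2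
    ⟨(Walk.cons_isCycle_iff w hba).2 ⟨hw, fun hmem => ?_⟩, hw.isHamiltonian_of_mem hall⟩⟩
  have h3 := hC.three_le
  rw [Multiset.coe_card, Walk.length_support,
    hw.length_eq_one_of_mem_edges (by rwa [Sym2.eq_swap])] at h3
  omega

end OreCycles

/-- **Theorem 9 of the paper.** Let `G` be a 2-connected o-heavy graph. If every
pair of vertices at distance 2 within an induced copy `H` of `Z₂` (namely the
pairs `{a₂,b₁}`, `{a₃,b₁}` and `{a₁,c₁}`) satisfies Fan's or Shi's condition in
`G`, then `G` is Hamiltonian. -/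
theorem ning_zhang_chen_th9 {V : Type*} [Fintype V] [DecidableEq V]
    (G : SimpleGraph V) [DecidableRel G.Adj]
    (h2 : TwoConnected G)
    (hheavy : OHeavy G)
    (h : ∀ a1 a2 a3 b1 c1 : V, IsInducedZ2 G a1 a2 a3 b1 c1 →
      FanOrShi G a2 b1 ∧ FanOrShi G a3 b1 ∧ FanOrShi G a1 c1) :
    G.IsHamiltonian := by
  obtain ⟨S, hC⟩ := exists_isMaxCycle h2
  refine hC.isHamiltonian fun x => ?_
  by_contra hx
  obtain ⟨E, y, z, u, v, hE, hu, hv, huv, hyu, hzv⟩ :=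
    exists_outer h2 hx hC.nodup hC.three_le
  exact hC.not_outer hheavy h hE hu hv huv hyu hzv
end
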